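/- For every real s ≥ 11 and every A > 0 there exist τ ∈ (0,1), λ > 0 and a finitely supported even initial datum a : ℤ² → ℝ (namely a = λ·p_τ for suitable λ, τ) with a_0 = 0, a_k = 0 whenever k₂ is odd, and Σ_{k∈ℤ²} (1+|k|²)^s a_k² ≤ 1, such that every even, rapidly decaying Fourier-side solution θ̂ of the SQG equation with θ̂_k(0) = a_k for all k, and satisfying θ̂_k(t) = 0 for all t ≥ 0 whenever k₂ is odd, obeys limsup_{t→∞} Σ_{k∈ℤ²} (1+|k|²)^s θ̂_k(t)² ≥ A². -/

import Mathlib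

open scoped BigOperators

noncomputable section

/-- Euclidean norm of a lattice point `k ∈ ℤ²`. -/
def znorm (k : ℤ × ℤ) : ℝ := Real.sqrt ((k.1 : ℝ) ^ 2 + (k.2 : ℝ) ^ 2)

/-- Wedge product `l ∧ m = l₁ m₂ − l₂ m₁`. -/
def wedge (l m : ℤ × ℤ) : ℝ := ((l.1 * m.2 - l.2 * m.1 : ℤ) : ℝ)

/-- The summand of the Fourier-side SQG nonlinearity at frequency `k`,
parametrized by `l` (with `m = k - l`); it is set to `0` unless `l ≠ 0` and `m ≠ 0`. -/
def sqgSummand (a : ℤ × ℤ → ℝ) (k l : ℤ × ℤ) : ℝ :=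
  if l ≠ 0 ∧ k - l ≠ 0 then
    wedge l (k - l) * (1 / znorm l - 1 / znorm (k - l)) * a l * a (k - l)
  else 0

/-- An even, rapidly decaying Fourier-side solution of the conservative SQG equation
on `[0,∞)` (modelled as a family `θ : ℝ → ℤ² → ℝ` whose defining properties are
imposed for `t ≥ 0`). -/
structure SQGSol where
  θ : ℝ → ℤ × ℤ → ℝ
  zero_mode : ∀ t : ℝ, 0 ≤ t → θ t 0 = 0
  /-- the nonlinearity is an absolutely convergent sum -/
  rhs_summable : ∀ t : ℝ, 0 ≤ t → ∀ k : ℤ × ℤ,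
    Summable fun l : ℤ × ℤ => |sqgSummand (θ t) k l|
  /-- each `t ↦ θ̂_k(t)` is differentiable on `[0,∞)` and satisfies the SQG ODE -/
  ode : ∀ (k : ℤ × ℤ) (t : ℝ), 0 ≤ t →
    HasDerivWithinAt (fun s => θ s k)
      ((1 / 2) * ∑' l : ℤ × ℤ, sqgSummand (θ t) k l) (Set.Ici 0) t
  /-- rapid decay: for every `T > 0` and `N ∈ ℕ`,
  `sup_{0 ≤ t ≤ T} sup_k (1+|k|)^N |θ̂_k(t)| < ∞` -/
  decay : ∀ T : ℝ, 0 < T → ∀ N : ℕ, ∃ M : ℝ,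
    ∀ t ∈ Set.Icc (0 : ℝ) T, ∀ k : ℤ × ℤ, (1 + znorm k) ^ N * |θ t k| ≤ M

/-- The solution is even: `θ̂_{-k}(t) = θ̂_k(t)`. -/
def SQGSol.IsEven (Θ : SQGSol) : Prop :=
  ∀ t : ℝ, 0 ≤ t → ∀ k : ℤ × ℤ, Θ.θ t (-k) = Θ.θ t k

/-- The initial datum `p_τ`: value `1` at `±e = ±(1,0)`, value `τ` at
`±g = ±(0,2)` and `±(g+e) = ±(1,2)`, and `0` elsewhere. -/
def pdat (τ : ℝ) : ℤ × ℤ → ℝ := fun k =>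
  if k = (1, 0) ∨ k = (-1, 0) then 1
  else if k = (0, 2) ∨ k = (0, -2) ∨ k = (1, 2) ∨ k = (-1, -2) then τ
  else 0


open scoped BigOperators
noncomputable section

/-! ### Basic facts on the norm -/

lemma znorm_nonneg (k : ℤ × ℤ) : 0 ≤ znorm k := Real.sqrt_nonneg _

lemma znorm_sq (k : ℤ × ℤ) : znorm k ^ 2 = (k.1 : ℝ) ^ 2 + (k.2 : ℝ) ^ 2 :=
  Real.sq_sqrt (by positivity)

lemma abs_fst_le (k : ℤ × ℤ) : |(k.1 : ℝ)| ≤ znorm k :=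
  Real.abs_le_sqrt (by nlinarith [sq_nonneg (k.2 : ℝ)])

lemma abs_snd_le (k : ℤ × ℤ) : |(k.2 : ℝ)| ≤ znorm k :=
  Real.abs_le_sqrt (by nlinarith [sq_nonneg (k.1 : ℝ)])

lemma znorm_zero : znorm 0 = 0 := by simp [znorm]

lemma znorm_neg (k : ℤ × ℤ) : znorm (-k) = znorm k := by simp [znorm]

lemma znorm_add_le (k l : ℤ × ℤ) : znorm (k + l) ≤ znorm k + znorm l := by
  have h1 := znorm_sq k
  have h2 := znorm_sq l
  have h3 := znorm_sq (k + l)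
  have n1 := znorm_nonneg k
  have n2 := znorm_nonneg l
  have n3 := znorm_nonneg (k + l)
  simp only [Prod.fst_add, Prod.snd_add, Int.cast_add] at h3
  have h4 : (k.1 : ℝ) * l.1 + k.2 * l.2 ≤ znorm k * znorm l := by
    apply le_of_sq_le_sq _ (by positivity)
    rw [mul_pow, h1, h2]
    nlinarith [sq_nonneg ((k.1 : ℝ) * l.2 - k.2 * l.1)]
  apply le_of_sq_le_sq _ (by positivity)
  nlinarith

lemma abs_wedge_le (k l : ℤ × ℤ) : |wedge k l| ≤ znorm k * znorm l := by
  have h1 := znorm_sq k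
  have h2 := znorm_sq l
  have n1 := znorm_nonneg k
  have n2 := znorm_nonneg l
  apply abs_le_of_sq_le_sq _ (by positivity)
  rw [mul_pow, h1, h2]
  simp only [wedge]
  push_cast
  nlinarith [sq_nonneg ((k.1 : ℝ) * l.1 + k.2 * l.2)]

lemma one_le_znorm {k : ℤ × ℤ} (hk : k ≠ 0) : 1 ≤ znorm k := by
  have h : 1 ≤ k.1 ^ 2 + k.2 ^ 2 := by
    by_contra hc
    push Not at hc
    have h1 : k.1 ^ 2 = 0 := by nlinarith [sq_nonneg k.1, sq_nonneg k.2]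
    have h2 : k.2 ^ 2 = 0 := by nlinarith [sq_nonneg k.1, sq_nonneg k.2]
    apply hk
    ext
    · simpa using h1
    · simpa using h2
  have h' : (1 : ℝ) ≤ (k.1 : ℝ) ^ 2 + (k.2 : ℝ) ^ 2 := by exact_mod_cast h
  rw [znorm]
  exact Real.one_le_sqrt.mpr h'

lemma znorm_pos {k : ℤ × ℤ} (hk : k ≠ 0) : 0 < znorm k :=
  lt_of_lt_of_le one_pos (one_le_znorm hk)

/-- the interaction kernel -/
def ker (l m : ℤ × ℤ) : ℝ := wedge l m * (1 / znorm l - 1 / znorm m)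

lemma abs_wedge_div_le (l m : ℤ × ℤ) : |wedge l m * (1 / znorm l)| ≤ znorm m := by
  by_cases hl : l = 0
  · subst hl
    simp [wedge, znorm_nonneg]
  · have := znorm_pos hl
    rw [abs_mul, abs_of_nonneg (by positivity : 0 ≤ 1 / znorm l), mul_one_div,
      div_le_iff₀ this, mul_comm (znorm m)]
    exact abs_wedge_le l m

lemma wedge_swap (l m : ℤ × ℤ) : wedge m l = - wedge l m := by
  simp only [wedge]; push_cast; ring

lemma abs_ker_le (l m : ℤ × ℤ) : |ker l m| ≤ znorm l + znorm m := by
  have h1 := abs_wedge_div_le l m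
  have h2 := abs_wedge_div_le m l
  rw [wedge_swap, neg_mul, abs_neg] at h2
  rw [ker, mul_sub]
  have := abs_sub (wedge l m * (1 / znorm l)) (wedge l m * (1 / znorm m))
  linarith

lemma sqgSummand_eq (a : ℤ × ℤ → ℝ) (k l : ℤ × ℤ) :
    sqgSummand a k l = ker l (k - l) * a l * a (k - l) := by
  unfold sqgSummand
  split_ifs with h
  · rfl
  · rw [not_and_or, not_not, not_not] at h
    rcases h with h | h
    · simp [h, ker, wedge]
    · rw [h]; simp [ker, wedge]

/-! ### Summability -/

/-- reference summable weight -/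
def om (k : ℤ × ℤ) : ℝ := ((1 + |(k.1 : ℝ)|) ^ 2)⁻¹ * ((1 + |(k.2 : ℝ)|) ^ 2)⁻¹

lemma om_pos (k : ℤ × ℤ) : 0 < om k := by unfold om; positivity

lemma summable_om : Summable om := by
  have h1 : Summable fun n : ℤ => ((1 + |(n : ℝ)|) ^ 2)⁻¹ := by
    have hn : Summable fun n : ℕ => ((1 + |(n : ℝ)|) ^ 2)⁻¹ := by
      have := (summable_nat_add_iff (f := fun n : ℕ => ((n : ℝ) ^ 2)⁻¹) 1).mpr
        (Real.summable_nat_pow_inv.mpr one_lt_two)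
      refine this.congr fun n => ?_
      push_cast
      rw [abs_of_nonneg (by positivity : (0 : ℝ) ≤ n), add_comm]
    refine Summable.of_nat_of_neg (by simpa using hn) ?_
    simpa using hn
  exact h1.mul_of_nonneg h1 (fun n => by positivity) (fun n => by positivity)

lemma inv_pow_le_om (k : ℤ × ℤ) : ((1 + znorm k) ^ 4)⁻¹ ≤ om k := by
  unfold om
  rw [← mul_inv]
  apply inv_anti₀ (by positivity)
  have h1 := abs_fst_le k
  have h2 := abs_snd_le k
  calc (1 + |(k.1 : ℝ)|) ^ 2 * (1 + |(k.2 : ℝ)|) ^ 2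
      ≤ (1 + znorm k) ^ 2 * (1 + znorm k) ^ 2 := by gcongr
    _ = (1 + znorm k) ^ 4 := by ring

/-- total mass of the reference weight -/
def omS : ℝ := ∑' k, om k

lemma omS_pos : 0 < omS := summable_om.tsum_pos (fun k => (om_pos k).le) 0 (om_pos 0)

lemma le_om_of_decay {x M : ℝ} {k : ℤ × ℤ} (h : (1 + znorm k) ^ 4 * |x| ≤ M) :
    |x| ≤ M * om k := by
  have h0 : 0 < (1 + znorm k) ^ 4 := by have := znorm_nonneg k; positivity
  have hM : 0 ≤ M := le_trans (by positivity) h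
  calc |x| = ((1 + znorm k) ^ 4 * |x|) * ((1 + znorm k) ^ 4)⁻¹ := by
        rw [mul_comm _ |x|, mul_assoc, mul_inv_cancel₀ h0.ne', mul_one]
    _ ≤ M * om k := mul_le_mul h (inv_pow_le_om k) (by positivity) hM

/-- Polynomially bounded weights -/
def PB (w : ℤ × ℤ → ℝ) : Prop := ∃ (C : ℝ) (q : ℕ), ∀ k, |w k| ≤ C * (1 + znorm k) ^ q

/-- uniformly rapidly decaying families -/
def UD (S : Set ℝ) (u : ℝ → ℤ × ℤ → ℝ) : Prop :=
  ∀ N : ℕ, ∃ M : ℝ, ∀ t ∈ S, ∀ k, (1 + znorm k) ^ N * |u t k| ≤ M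

lemma UD.mono {S S' : Set ℝ} {u} (h : UD S u) (hs : S' ⊆ S) : UD S' u := fun N => by
  obtain ⟨M, hM⟩ := h N
  exact ⟨M, fun t ht => hM t (hs ht)⟩

lemma UD.add {S : Set ℝ} {u v} (hu : UD S u) (hv : UD S v) : UD S (fun t k => u t k + v t k) :=
  fun N => by
  obtain ⟨M, hM⟩ := hu N
  obtain ⟨M', hM'⟩ := hv N
  refine ⟨M + M', fun t ht k => ?_⟩
  have h0 : 0 ≤ (1 + znorm k) ^ N := by have := znorm_nonneg k; positivity
  calc _ ≤ (1 + znorm k) ^ N * (|u t k| + |v t k|) := by gcongr; exact abs_add_le _ _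
    _ ≤ _ := by rw [mul_add]; exact add_le_add (hM t ht k) (hM' t ht k)

lemma UD.weight {S : Set ℝ} {u} {w} (hu : UD S u) (hw : PB w) : UD S (fun t k => w k * u t k) :=
  fun N => by
  obtain ⟨C, q, hC⟩ := hw
  obtain ⟨M, hM⟩ := hu (N + q)
  refine ⟨|C| * M, fun t ht k => ?_⟩
  have h0 : 0 ≤ 1 + znorm k := by have := znorm_nonneg k; positivity
  calc (1 + znorm k) ^ N * |w k * u t k| = (1 + znorm k) ^ N * (|w k| * |u t k|) := by rw [abs_mul]
    _ ≤ (1 + znorm k) ^ N * ((|C| * (1 + znorm k) ^ q) * |u t k|) := by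
        gcongr
        exact (hC k).trans (by gcongr; exact le_abs_self C)
    _ = |C| * ((1 + znorm k) ^ (N + q) * |u t k|) := by rw [pow_add]; ring
    _ ≤ _ := by gcongr; exact hM t ht k

lemma UD.mul {S : Set ℝ} {u v} (hu : UD S u) (hv : UD S v) : UD S (fun t k => u t k * v t k) :=
  fun N => by
  obtain ⟨M, hM⟩ := hu N
  obtain ⟨M', hM'⟩ := hv 0
  refine ⟨M * M', fun t ht k => ?_⟩
  have h0 : 0 ≤ (1 + znorm k) ^ N := by have := znorm_nonneg k; positivity
  have h1 := hM t ht k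
  have h2 := hM' t ht k
  rw [pow_zero, one_mul] at h2
  rw [abs_mul, ← mul_assoc]
  exact mul_le_mul h1 h2 (abs_nonneg _) (le_trans (by positivity) h1)

lemma one_add_znorm_le (k j : ℤ × ℤ) : 1 + znorm k ≤ (1 + znorm j) * (1 + znorm (k + j)) := by
  have := znorm_add_le (k + j) (-j)
  rw [add_neg_cancel_right, znorm_neg] at this
  nlinarith [znorm_nonneg (k + j), znorm_nonneg j]

lemma UD.shift {S : Set ℝ} {u} (hu : UD S u) (j : ℤ × ℤ) : UD S (fun t k => u t (k + j)) :=
  fun N => by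
  obtain ⟨M, hM⟩ := hu N
  refine ⟨(1 + znorm j) ^ N * M, fun t ht k => ?_⟩
  have h0 := znorm_nonneg k
  have h1 := znorm_nonneg j
  have h2 := znorm_nonneg (k + j)
  calc (1 + znorm k) ^ N * |u t (k + j)|
      ≤ ((1 + znorm j) * (1 + znorm (k + j))) ^ N * |u t (k + j)| := by
        gcongr; exact one_add_znorm_le k j
    _ = (1 + znorm j) ^ N * ((1 + znorm (k + j)) ^ N * |u t (k + j)|) := by rw [mul_pow]; ring
    _ ≤ _ := by gcongr; exact hM t ht _

lemma UD.bound {S : Set ℝ} {u} (hu : UD S u) :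
    ∃ M : ℝ, ∀ t ∈ S, ∀ k, |u t k| ≤ M * om k := by
  obtain ⟨M, hM⟩ := hu 4
  exact ⟨M, fun t ht k => le_om_of_decay (hM t ht k)⟩

lemma UD.summable {S : Set ℝ} {u} (hu : UD S u) {t : ℝ} (ht : t ∈ S) : Summable (u t) := by
  obtain ⟨M, hM⟩ := hu.bound
  exact Summable.of_abs (Summable.of_nonneg_of_le (fun _ => abs_nonneg _) (hM t ht)
    (summable_om.mul_left M))

lemma PB.const (c : ℝ) : PB (fun _ => c) := ⟨|c|, 0, fun k => by simp⟩

lemma PB.of_bdd {w : ℤ × ℤ → ℝ} (C : ℝ) (h : ∀ k, |w k| ≤ C) : PB w :=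
  ⟨C, 0, fun k => by simpa using h k⟩

lemma PB.znorm : PB znorm := ⟨1, 1, fun k => by
  rw [abs_of_nonneg (znorm_nonneg k)]; linarith [znorm_nonneg k]⟩

lemma PB.fst : PB (fun k => (k.1 : ℝ)) := ⟨1, 1, fun k => by
  have := abs_fst_le k; linarith [znorm_nonneg k]⟩

lemma PB.snd : PB (fun k => (k.2 : ℝ)) := ⟨1, 1, fun k => by
  have := abs_snd_le k; linarith [znorm_nonneg k]⟩

lemma PB.mul {v w : ℤ × ℤ → ℝ} (hv : PB v) (hw : PB w) : PB (fun k => v k * w k) := by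
  obtain ⟨C, q, hC⟩ := hv
  obtain ⟨C', q', hC'⟩ := hw
  refine ⟨C * C', q + q', fun k => ?_⟩
  rw [abs_mul, pow_add]
  calc _ ≤ (C * (1 + _root_.znorm k) ^ q) * (C' * (1 + _root_.znorm k) ^ q') :=
        mul_le_mul (hC k) (hC' k) (abs_nonneg _) ((abs_nonneg _).trans (hC k))
    _ = _ := by ring

lemma PB.add {v w : ℤ × ℤ → ℝ} (hv : PB v) (hw : PB w) : PB (fun k => v k + w k) := by
  obtain ⟨C, q, hC⟩ := hv
  obtain ⟨C', q', hC'⟩ := hw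
  refine ⟨|C| + |C'|, q + q', fun k => ?_⟩
  have h0 := znorm_nonneg k
  have e1 : C * (1 + _root_.znorm k) ^ q ≤ |C| * (1 + _root_.znorm k) ^ (q + q') :=
    mul_le_mul (le_abs_self C) (pow_le_pow_right₀ (by linarith) (by omega)) (by positivity)
      (by positivity)
  have e2 : C' * (1 + _root_.znorm k) ^ q' ≤ |C'| * (1 + _root_.znorm k) ^ (q + q') :=
    mul_le_mul (le_abs_self C') (pow_le_pow_right₀ (by linarith) (by omega)) (by positivity)
      (by positivity)
  have := abs_add_le (v k) (w k)
  have := hC k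
  have := hC' k
  rw [add_mul]; linarith

lemma PB.shift {w : ℤ × ℤ → ℝ} (hw : PB w) (j : ℤ × ℤ) : PB (fun k => w (k + j)) := by
  obtain ⟨C, q, hC⟩ := hw
  refine ⟨|C| * (1 + _root_.znorm j) ^ q, q, fun k => ?_⟩
  have h0 := znorm_nonneg k
  have h1 := znorm_nonneg j
  have h2 := znorm_nonneg (k + j)
  calc |w (k + j)| ≤ C * (1 + _root_.znorm (k + j)) ^ q := hC _
    _ ≤ |C| * ((1 + _root_.znorm j) * (1 + _root_.znorm k)) ^ q := by
        have := znorm_add_le k j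
        gcongr
        · exact le_abs_self C
        · nlinarith
    _ = _ := by rw [mul_pow]; ring

lemma PB.ite {w : ℤ × ℤ → ℝ} (hw : PB w) (p : ℤ × ℤ → Prop) [DecidablePred p] :
    PB (fun k => if p k then w k else 0) := by
  obtain ⟨C, q, hC⟩ := hw
  refine ⟨C, q, fun k => ?_⟩
  dsimp only
  split_ifs
  · exact hC k
  · rw [abs_zero]; exact (abs_nonneg _).trans (hC k)

/-- termwise differentiation -/
lemma hasDerivAt_tsum_UD {T : ℝ} {u u' : ℝ → ℤ × ℤ → ℝ}
    (hd : ∀ k, ∀ t ∈ Set.Ioo 0 T, HasDerivAt (fun s => u s k) (u' t k) t)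
    (hu : UD (Set.Ioo 0 T) u) (hu' : UD (Set.Ioo 0 T) u') {t : ℝ} (ht : t ∈ Set.Ioo 0 T) :
    HasDerivAt (fun s => ∑' k, u s k) (∑' k, u' t k) t := by
  obtain ⟨M, hM⟩ := hu'.bound
  exact hasDerivAt_tsum_of_isPreconnected (summable_om.mul_left M) isOpen_Ioo isPreconnected_Ioo
    (fun k s hs => hd k s hs) (fun k s hs => by simpa using hM s hs k) ht (hu.summable ht) ht
end


open scoped BigOperators
noncomputable section

/-- the nonlinearity -/
def Dn (a : ℤ × ℤ → ℝ) (k : ℤ × ℤ) : ℝ := (1 / 2) * ∑' l, ker l (k - l) * a l * a (k - l)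

lemma one_add_znorm_add_le (k l : ℤ × ℤ) :
    1 + znorm k ≤ (1 + znorm l) * (1 + znorm (k - l)) := by
  have := znorm_add_le l (k - l)
  rw [add_sub_cancel] at this
  nlinarith [znorm_nonneg l, znorm_nonneg (k - l)]

lemma UD.conv_bound {S : Set ℝ} {u} (hu : UD S u) (N : ℕ) : ∃ M : ℝ, 0 ≤ M ∧ ∀ t ∈ S, ∀ k l,
    (1 + znorm k) ^ N * |ker l (k - l) * u t l * u t (k - l)| ≤ M * om l := by
  obtain ⟨M1, hM1⟩ := hu (N + 1 + 4)
  obtain ⟨M2, hM2⟩ := hu (N + 1)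
  refine ⟨|M1| * |M2|, by positivity, fun t ht k l => ?_⟩
  have n1 := znorm_nonneg k
  have n2 := znorm_nonneg l
  have n3 := znorm_nonneg (k - l)
  have h1 : (1 + znorm l) ^ (N + 1) * |u t l| ≤ |M1| * om l := by
    have := @le_om_of_decay ((1 + znorm l) ^ (N + 1) * u t l) M1 l (by
      rw [abs_mul, abs_of_nonneg (by positivity : 0 ≤ (1 + znorm l) ^ (N + 1)), ← mul_assoc,
        mul_comm (_ ^ 4), ← pow_add]
      exact hM1 t ht l)
    rw [abs_mul, abs_of_nonneg (by positivity : 0 ≤ (1 + znorm l) ^ (N + 1))] at this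
    exact this.trans (mul_le_mul_of_nonneg_right (le_abs_self _) (om_pos l).le)
  have h2 : (1 + znorm (k - l)) ^ (N + 1) * |u t (k - l)| ≤ |M2| :=
    (hM2 t ht _).trans (le_abs_self _)
  have hk : |ker l (k - l)| ≤ (1 + znorm l) * (1 + znorm (k - l)) := by
    have := abs_ker_le l (k - l)
    nlinarith
  have hN : (1 + znorm k) ^ N ≤ ((1 + znorm l) * (1 + znorm (k - l))) ^ N := by
    gcongr; exact one_add_znorm_add_le k l
  rw [abs_mul, abs_mul]
  calc (1 + znorm k) ^ N * (|ker l (k - l)| * |u t l| * |u t (k - l)|)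
      ≤ ((1 + znorm l) * (1 + znorm (k - l))) ^ N *
        (((1 + znorm l) * (1 + znorm (k - l))) * |u t l| * |u t (k - l)|) := by gcongr
    _ = ((1 + znorm l) ^ (N + 1) * |u t l|) * ((1 + znorm (k - l)) ^ (N + 1) * |u t (k - l)|) := by
        rw [mul_pow]; ring
    _ ≤ (|M1| * om l) * |M2| := mul_le_mul h1 h2 (by positivity)
        (mul_nonneg (abs_nonneg _) (om_pos l).le)
    _ = _ := by ring

lemma UD.conv_summable {S : Set ℝ} {u} (hu : UD S u) {t : ℝ} (ht : t ∈ S) (k : ℤ × ℤ) :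
    Summable fun l => ker l (k - l) * u t l * u t (k - l) := by
  obtain ⟨M, -, hM⟩ := hu.conv_bound 0
  refine Summable.of_abs (Summable.of_nonneg_of_le (fun _ => abs_nonneg _) (fun l => ?_)
    (summable_om.mul_left M))
  simpa using hM t ht k l

lemma UD.conv_summable2 {S : Set ℝ} {u} (hu : UD S u) {t : ℝ} (ht : t ∈ S)
    (w : ℤ × ℤ → ℝ) (C : ℝ) (hw : ∀ k, |w k| ≤ C) :
    Summable fun z : (ℤ × ℤ) × (ℤ × ℤ) =>
      w z.1 * (ker z.2 (z.1 - z.2) * u t z.2 * u t (z.1 - z.2)) := by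
  obtain ⟨M, hM0, hM⟩ := hu.conv_bound 4
  have hs : Summable fun z : (ℤ × ℤ) × (ℤ × ℤ) => (C * M) * (om z.1 * om z.2) :=
    (summable_om.mul_of_nonneg summable_om (fun k => (om_pos k).le)
      (fun k => (om_pos k).le)).mul_left _
  refine Summable.of_abs (Summable.of_nonneg_of_le (fun _ => abs_nonneg _) (fun z => ?_) hs)
  rw [abs_mul]
  have h1 := le_om_of_decay (hM t ht z.1 z.2)
  calc |w z.1| * _ ≤ C * (M * om z.2 * om z.1) := by
        apply mul_le_mul (hw _) h1 (abs_nonneg _) ((abs_nonneg _).trans (hw 0))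
    _ = _ := by ring

lemma UD.Dn {S : Set ℝ} {u} (hu : UD S u) : UD S (fun t => Dn (u t)) := fun N => by
  obtain ⟨M, -, hM⟩ := hu.conv_bound N
  refine ⟨M * omS, fun t ht k => ?_⟩
  have hs := hu.conv_summable ht k
  have n1 := znorm_nonneg k
  have h0 : 0 ≤ (1 + znorm k) ^ N := by positivity
  have h1 : |∑' l, ker l (k - l) * u t l * u t (k - l)| ≤
      ∑' l, |ker l (k - l) * u t l * u t (k - l)| := by
    simpa using norm_tsum_le_tsum_norm hs.norm
  calc (1 + znorm k) ^ N * |_root_.Dn (u t) k|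
      ≤ (1 + znorm k) ^ N * ∑' l, |ker l (k - l) * u t l * u t (k - l)| := by
        gcongr
        rw [_root_.Dn, abs_mul, abs_of_pos (by norm_num : (0 : ℝ) < 1 / 2)]
        linarith [abs_nonneg (∑' l, ker l (k - l) * u t l * u t (k - l))]
    _ = ∑' l, (1 + znorm k) ^ N * |ker l (k - l) * u t l * u t (k - l)| := tsum_mul_left.symm
    _ ≤ ∑' l, M * om l := (hs.abs.mul_left _).tsum_le_tsum (fun l => hM t ht k l)
        (summable_om.mul_left M)
    _ = M * omS := tsum_mul_left

/-- cyclic relabelling of triads -/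
def cyc : ((ℤ × ℤ) × (ℤ × ℤ)) ≃ ((ℤ × ℤ) × (ℤ × ℤ)) where
  toFun z := (-z.2, z.1 - z.2)
  invFun z := (z.2 - z.1, -z.1)
  left_inv z := by ext <;> simp
  right_inv z := by ext <;> simp

lemma conserved_aux {S : Set ℝ} {u} (hu : UD S u) {t : ℝ} (ht : t ∈ S)
    (hev : ∀ k, u t (-k) = u t k) (α β : ℝ) :
    ∑' k, ((α + β / znorm k) * u t k) * Dn (u t) k = 0 := by
  obtain ⟨M, hM⟩ := hu 0
  have hw : ∀ k, |(α + β / znorm k) * u t k| ≤ (|α| + |β|) * M := fun k => by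
    rw [abs_mul]
    have h2 : |u t k| ≤ M := by simpa using hM t ht k
    refine mul_le_mul ?_ h2 (abs_nonneg _) (by positivity)
    refine (abs_add_le _ _).trans (add_le_add le_rfl ?_)
    by_cases hk : k = 0
    · subst hk; simp [znorm_zero]
    · rw [abs_div, abs_of_nonneg (znorm_nonneg k)]
      exact div_le_self (abs_nonneg _) (one_le_znorm hk)
  have hs := hu.conv_summable2 ht _ _ hw
  set f : (ℤ × ℤ) × (ℤ × ℤ) → ℝ := fun z => ((α + β / znorm z.1) * u t z.1) *
    (ker z.2 (z.1 - z.2) * u t z.2 * u t (z.1 - z.2)) with hf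
  have e1 : ∑' k, ((α + β / znorm k) * u t k) * Dn (u t) k = (1 / 2) * ∑' z, f z := by
    rw [hs.tsum_prod, ← tsum_mul_left]
    congr 1
    ext k
    simp only [hf, tsum_mul_left, Dn]
    ring
  have c1 : ∑' z, f (cyc z) = ∑' z, f z := cyc.tsum_eq f
  have c2 : ∑' z, f (cyc (cyc z)) = ∑' z, f z := by
    rw [← c1]; exact cyc.tsum_eq (fun z => f (cyc z))
  have s1 : Summable fun z => f (cyc z) := cyc.summable_iff.mpr hs
  have s2 : Summable fun z => f (cyc (cyc z)) := cyc.summable_iff.mpr s1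
  have key : ∀ z, f z + f (cyc z) + f (cyc (cyc z)) = 0 := fun z => by
    obtain ⟨k, l⟩ := z
    have a1 : cyc (k, l) = (-l, k - l) := rfl
    have a2 : cyc (cyc (k, l)) = (-(k - l), -k) := by
      rw [a1]; change (_, _) = _; ext <;> simp <;> ring
    rw [a2, a1, hf]
    dsimp only
    have b1 : -l - (k - l) = -k := by abel
    have b2 : -(k - l) - -k = l := by abel
    have w1 : wedge (k - l) (-k) = wedge l (k - l) := by
      simp only [wedge, Prod.fst_sub, Prod.snd_sub, Prod.fst_neg, Prod.snd_neg]; push_cast; ring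
    have w2 : wedge (-k) l = wedge l (k - l) := by
      simp only [wedge, Prod.fst_sub, Prod.snd_sub, Prod.fst_neg, Prod.snd_neg]; push_cast; ring
    rw [b1, b2]
    simp only [ker, hev, znorm_neg, w1, w2]
    ring
  have h3 : ∑' z, (f z + f (cyc z) + f (cyc (cyc z))) = 0 := by simp [key]
  rw [(hs.add s1).tsum_add s2, hs.tsum_add s1, c1, c2] at h3
  rw [e1]
  linarith

lemma SQGSol.UD (Θ : SQGSol) {T : ℝ} (hT : 0 < T) : UD (Set.Icc 0 T) Θ.θ := Θ.decay T hT

lemma SQGSol.deriv (Θ : SQGSol) (k : ℤ × ℤ) {t : ℝ} (ht : 0 < t) :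
    HasDerivAt (fun s => Θ.θ s k) (Dn (Θ.θ t) k) t := by
  have := (Θ.ode k t ht.le).hasDerivAt (Ici_mem_nhds ht)
  simp only [sqgSummand_eq] at this
  exact this

lemma SQGSol.cont (Θ : SQGSol) (k : ℤ × ℤ) : ContinuousOn (fun s => Θ.θ s k) (Set.Ici 0) :=
  fun t ht => (Θ.ode k t ht).continuousWithinAt

/-- derivative of a quadratic functional -/
lemma SQGSol.quad_deriv (Θ : SQGSol) {w : ℤ × ℤ → ℝ} (hw : PB w) (j : ℤ × ℤ) {t : ℝ} (ht : 0 < t) :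
    HasDerivAt (fun s => ∑' k, w k * (Θ.θ s k * Θ.θ s (k + j)))
      (∑' k, w k * (Dn (Θ.θ t) k * Θ.θ t (k + j) + Θ.θ t k * Dn (Θ.θ t) (k + j))) t := by
  have hT : 0 < t + 1 := by linarith
  have hu : _root_.UD (Set.Ioo 0 (t + 1)) Θ.θ := (Θ.UD hT).mono Set.Ioo_subset_Icc_self
  refine hasDerivAt_tsum_UD (T := t + 1) (u := fun s k => w k * (Θ.θ s k * Θ.θ s (k + j)))
    (u' := fun t k => w k * (Dn (Θ.θ t) k * Θ.θ t (k + j) + Θ.θ t k * Dn (Θ.θ t) (k + j)))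
    (fun k s hs => ?_) ?_ ?_ ⟨ht, by linarith⟩
  · exact ((Θ.deriv k hs.1).mul (Θ.deriv (k + j) hs.1)).const_mul _
  · exact (hu.mul (hu.shift j)).weight hw
  · exact ((hu.Dn.mul (hu.shift j)).add (hu.mul (hu.Dn.shift j))).weight hw

lemma SQGSol.quad_cont (Θ : SQGSol) {w : ℤ × ℤ → ℝ} (hw : PB w) {T : ℝ} (hT : 0 < T) :
    ContinuousOn (fun s => ∑' k, w k * (Θ.θ s k * Θ.θ s k)) (Set.Icc 0 T) := by
  obtain ⟨M, hM⟩ := (((Θ.UD hT).mul (Θ.UD hT)).weight hw).bound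
  refine continuousOn_tsum (fun k => ?_) (summable_om.mul_left M)
    (fun k s hs => by simpa using hM s hs k)
  have : ContinuousOn (fun s => Θ.θ s k) (Set.Icc 0 T) := (Θ.cont k).mono (fun x hx => hx.1)
  exact continuousOn_const.mul (this.mul this)

lemma SQGSol.conserved (Θ : SQGSol) (hev : Θ.IsEven) (α β : ℝ) {t : ℝ} (ht : 0 ≤ t) :
    ∑' k, (α + β / znorm k) * (Θ.θ t k * Θ.θ t k) =
      ∑' k, (α + β / znorm k) * (Θ.θ 0 k * Θ.θ 0 k) := by
  rcases ht.eq_or_lt with rfl | ht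
  · rfl
  have hw : PB (fun k => α + β / znorm k) := by
    refine PB.add (PB.const α) (PB.of_bdd |β| fun k => ?_)
    by_cases hk : k = 0
    · subst hk; simp [znorm_zero]
    · rw [abs_div, abs_of_nonneg (znorm_nonneg k)]
      exact div_le_self (abs_nonneg _) (one_le_znorm hk)
  obtain ⟨c, hc, h⟩ := exists_hasDerivAt_eq_slope _ (fun _ => 0) ht (Θ.quad_cont hw ht)
    (fun s hs => by
      have := Θ.quad_deriv hw 0 hs.1
      simp only [add_zero] at this
      convert this using 1
      have h0 := conserved_aux (Θ.UD hs.1) (t := s) ⟨hs.1.le, le_rfl⟩ (hev s hs.1.le) α β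
      have : ∀ k, (α + β / znorm k) * (Dn (Θ.θ s) k * Θ.θ s k + Θ.θ s k * Dn (Θ.θ s) k) =
        2 * (((α + β / znorm k) * Θ.θ s k) * Dn (Θ.θ s) k) := fun k => by ring
      simp only [this, tsum_mul_left, h0, mul_zero])
  have := (div_eq_zero_iff.mp h.symm).resolve_right (by linarith)
  linarith
end


open scoped BigOperators
noncomputable section

/-! ### Physical space -/

/-- rapidly decaying sequences -/
def RD (a : ℤ × ℤ → ℝ) : Prop := UD Set.univ (fun _ => a)

lemma UD.RD {S : Set ℝ} {u} (hu : UD S u) {t : ℝ} (ht : t ∈ S) : RD (u t) := fun N => by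
  obtain ⟨M, hM⟩ := hu N
  exact ⟨M, fun _ _ k => hM t ht k⟩

lemma RD.summable {a} (ha : RD a) : Summable a := UD.summable ha (Set.mem_univ 0)

lemma RD.weight {a w} (ha : RD a) (hw : PB w) : RD (fun k => w k * a k) := UD.weight ha hw

/-- phase -/
def dt (k : ℤ × ℤ) (z : ℝ × ℝ) : ℝ := k.1 * z.1 + k.2 * z.2

def Co (a : ℤ × ℤ → ℝ) (z : ℝ × ℝ) : ℝ := ∑' k, a k * Real.cos (dt k z)

def Si (a : ℤ × ℤ → ℝ) (z : ℝ × ℝ) : ℝ := ∑' k, a k * Real.sin (dt k z)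

lemma dt_cont (k : ℤ × ℤ) : Continuous (dt k) := by unfold dt; fun_prop

lemma cosdt_cont (k : ℤ × ℤ) : Continuous fun z => Real.cos (dt k z) :=
  Real.continuous_cos.comp (dt_cont k)

lemma abs_mul_cos_le (a x : ℝ) : |a * Real.cos x| ≤ |a| := by
  rw [abs_mul]; exact mul_le_of_le_one_right (abs_nonneg _) (Real.abs_cos_le_one x)

lemma abs_mul_sin_le (a x : ℝ) : |a * Real.sin x| ≤ |a| := by
  rw [abs_mul]; exact mul_le_of_le_one_right (abs_nonneg _) (Real.abs_sin_le_one x)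

lemma co_summable {a} (ha : RD a) (z : ℝ × ℝ) : Summable fun k => a k * Real.cos (dt k z) :=
  Summable.of_abs (ha.summable.abs.of_nonneg_of_le (fun _ => abs_nonneg _)
    (fun _ => abs_mul_cos_le _ _))

lemma si_summable {a} (ha : RD a) (z : ℝ × ℝ) : Summable fun k => a k * Real.sin (dt k z) :=
  Summable.of_abs (ha.summable.abs.of_nonneg_of_le (fun _ => abs_nonneg _)
    (fun _ => abs_mul_sin_le _ _))

lemma co_cont {a} (ha : RD a) : Continuous (Co a) :=
  continuous_tsum (fun k => continuous_const.mul (Real.continuous_cos.comp (dt_cont k)))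
    ha.summable.abs (fun _ _ => abs_mul_cos_le _ _)

lemma si_cont {a} (ha : RD a) : Continuous (Si a) :=
  continuous_tsum (fun k => continuous_const.mul (Real.continuous_sin.comp (dt_cont k)))
    ha.summable.abs (fun _ _ => abs_mul_sin_le _ _)

lemma dt_dx (k : ℤ × ℤ) (x y : ℝ) : HasDerivAt (fun x => dt k (x, y)) k.1 x := by
  unfold dt
  simpa using ((hasDerivAt_id x).const_mul (k.1 : ℝ)).add_const ((k.2 : ℝ) * y)

lemma dt_dy (k : ℤ × ℤ) (x y : ℝ) : HasDerivAt (fun y => dt k (x, y)) k.2 y := by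
  unfold dt
  simpa using ((hasDerivAt_id y).const_mul (k.2 : ℝ)).const_add ((k.1 : ℝ) * x)

lemma co_dx {a} (ha : RD a) (x y : ℝ) :
    HasDerivAt (fun x => Co a (x, y)) (-Si (fun k => (k.1 : ℝ) * a k) (x, y)) x := by
  have h := hasDerivAt_tsum (g := fun k x => a k * Real.cos (dt k (x, y)))
    (g' := fun k x => -(((k.1 : ℝ) * a k) * Real.sin (dt k (x, y))))
    (ha.weight PB.fst).summable.abs (fun k x => by
      exact (((dt_dx k x y).cos).const_mul (a k)).congr_deriv (by ring))
    (fun k x => by rw [norm_neg]; exact abs_mul_sin_le _ _) (y₀ := 0) (co_summable ha _) x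
  rw [tsum_neg] at h
  exact h

lemma co_dy {a} (ha : RD a) (x y : ℝ) :
    HasDerivAt (fun y => Co a (x, y)) (-Si (fun k => (k.2 : ℝ) * a k) (x, y)) y := by
  have h := hasDerivAt_tsum (g := fun k y => a k * Real.cos (dt k (x, y)))
    (g' := fun k y => -(((k.2 : ℝ) * a k) * Real.sin (dt k (x, y))))
    (ha.weight PB.snd).summable.abs (fun k y => by
      exact (((dt_dy k x y).cos).const_mul (a k)).congr_deriv (by ring))
    (fun k x => by rw [norm_neg]; exact abs_mul_sin_le _ _) (y₀ := 0) (co_summable ha _) y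
  rw [tsum_neg] at h
  exact h

lemma si_dx {a} (ha : RD a) (x y : ℝ) :
    HasDerivAt (fun x => Si a (x, y)) (Co (fun k => (k.1 : ℝ) * a k) (x, y)) x :=
  hasDerivAt_tsum (g := fun k x => a k * Real.sin (dt k (x, y)))
    (g' := fun k x => (((k.1 : ℝ) * a k) * Real.cos (dt k (x, y))))
    (ha.weight PB.fst).summable.abs (fun k x => by
      exact (((dt_dx k x y).sin).const_mul (a k)).congr_deriv (by ring))
    (fun k x => abs_mul_cos_le _ _) (y₀ := 0) (si_summable ha _) x

lemma si_dy {a} (ha : RD a) (x y : ℝ) :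
    HasDerivAt (fun y => Si a (x, y)) (Co (fun k => (k.2 : ℝ) * a k) (x, y)) y :=
  hasDerivAt_tsum (g := fun k y => a k * Real.sin (dt k (x, y)))
    (g' := fun k y => (((k.2 : ℝ) * a k) * Real.cos (dt k (x, y))))
    (ha.weight PB.snd).summable.abs (fun k y => by
      exact (((dt_dy k x y).sin).const_mul (a k)).congr_deriv (by ring))
    (fun k x => abs_mul_cos_le _ _) (y₀ := 0) (si_summable ha _) y

lemma cos_px (k : ℤ × ℤ) (y : ℝ) :
    Real.cos (dt k (2 * Real.pi, y)) = Real.cos (dt k (0, y)) := by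
  have : dt k (2 * Real.pi, y) = dt k (0, y) + k.1 * (2 * Real.pi) := by simp [dt]; ring
  rw [this, Real.cos_add_int_mul_two_pi]

lemma cos_py (k : ℤ × ℤ) (x : ℝ) :
    Real.cos (dt k (x, 2 * Real.pi)) = Real.cos (dt k (x, 0)) := by
  have : dt k (x, 2 * Real.pi) = dt k (x, 0) + k.2 * (2 * Real.pi) := by simp [dt]
  rw [this, Real.cos_add_int_mul_two_pi]

lemma sin_px (k : ℤ × ℤ) (y : ℝ) :
    Real.sin (dt k (2 * Real.pi, y)) = Real.sin (dt k (0, y)) := by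
  have : dt k (2 * Real.pi, y) = dt k (0, y) + k.1 * (2 * Real.pi) := by simp [dt]; ring
  rw [this, Real.sin_add_int_mul_two_pi]

lemma sin_py (k : ℤ × ℤ) (x : ℝ) :
    Real.sin (dt k (x, 2 * Real.pi)) = Real.sin (dt k (x, 0)) := by
  have : dt k (x, 2 * Real.pi) = dt k (x, 0) + k.2 * (2 * Real.pi) := by simp [dt]
  rw [this, Real.sin_add_int_mul_two_pi]

open MeasureTheory in
/-- measure on the period cell -/
def mu : Measure (ℝ × ℝ) :=
  ((volume : Measure ℝ).restrict (Set.Ioc 0 (2 * Real.pi))).prod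
    ((volume : Measure ℝ).restrict (Set.Ioc 0 (2 * Real.pi)))

open MeasureTheory

instance : IsFiniteMeasure mu := by unfold mu; infer_instance

lemma integrable_mu {G : ℝ × ℝ → ℝ} (hG : Continuous G) : Integrable G mu := by
  unfold mu
  rw [Measure.prod_restrict, ← Measure.volume_eq_prod]
  exact (hG.continuousOn.integrableOn_compact
    (isCompact_Icc.prod isCompact_Icc)).mono_set
      (Set.prod_mono Set.Ioc_subset_Icc_self Set.Ioc_subset_Icc_self)

lemma zero_y {G G' : ℝ × ℝ → ℝ} (hd : ∀ x y, HasDerivAt (fun y => G (x, y)) (G' (x, y)) y)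
    (hc : Continuous G') (hp : ∀ x, G (x, 2 * Real.pi) = G (x, 0)) : ∫ z, G' z ∂mu = 0 := by
  have h2 : (0 : ℝ) ≤ 2 * Real.pi := by positivity
  rw [mu, integral_prod _ (by have := integrable_mu hc; rwa [mu] at this)]
  have : ∀ x, ∫ y in Set.Ioc 0 (2 * Real.pi), G' (x, y) = 0 := fun x => by
    rw [← intervalIntegral.integral_of_le h2,
      intervalIntegral.integral_eq_sub_of_hasDerivAt (fun y _ => hd x y)
        ((hc.comp (by fun_prop : Continuous fun y : ℝ => (x, y))).intervalIntegrable _ _), hp,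
        sub_self]
  simp [this]

lemma zero_x {G G' : ℝ × ℝ → ℝ} (hd : ∀ x y, HasDerivAt (fun x => G (x, y)) (G' (x, y)) x)
    (hc : Continuous G') (hp : ∀ y, G (2 * Real.pi, y) = G (0, y)) : ∫ z, G' z ∂mu = 0 := by
  have h2 : (0 : ℝ) ≤ 2 * Real.pi := by positivity
  rw [mu, integral_prod_symm _ (by have := integrable_mu hc; rwa [mu] at this)]
  have : ∀ y, ∫ x in Set.Ioc 0 (2 * Real.pi), G' (x, y) = 0 := fun y => by
    rw [← intervalIntegral.integral_of_le h2,
      intervalIntegral.integral_eq_sub_of_hasDerivAt (fun x _ => hd x y)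
        ((hc.comp (by fun_prop : Continuous fun x : ℝ => (x, y))).intervalIntegrable _ _), hp,
        sub_self]
  simp [this]

/-- mass of the cell -/
def m0 : ℝ := ∫ _z : ℝ × ℝ, (1 : ℝ) ∂mu

lemma m0_pos : 0 < m0 := by
  have h2 : (0 : ℝ) ≤ 2 * Real.pi := by positivity
  rw [m0, mu, integral_prod _ (integrable_const _)]
  simp [h2]

lemma int_cos (k : ℤ × ℤ) : ∫ z, Real.cos (dt k z) ∂mu = if k = 0 then m0 else 0 := by
  split_ifs with hk
  · subst hk
    simp [dt, m0]
  · have hcc : Continuous fun z => Real.cos (dt k z) := Real.continuous_cos.comp (dt_cont k)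
    by_cases h1 : k.1 = 0
    · have h2 : (k.2 : ℝ) ≠ 0 := by
        intro h; apply hk; ext
        · exact h1
        · exact_mod_cast h
      refine zero_y (G := fun z => Real.sin (dt k z) / k.2) (fun x y => ?_) hcc (fun x => ?_)
      · exact (((dt_dy k x y).sin).div_const (k.2 : ℝ)).congr_deriv (by field_simp)
      · simp only [sin_py]
    · have h2 : (k.1 : ℝ) ≠ 0 := by exact_mod_cast h1
      refine zero_x (G := fun z => Real.sin (dt k z) / k.1) (fun x y => ?_) hcc (fun x => ?_)
      · exact (((dt_dx k x y).sin).div_const (k.1 : ℝ)).congr_deriv (by field_simp)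
      · simp only [sin_px]

lemma dt_add (k l : ℤ × ℤ) (z) : dt (k + l) z = dt k z + dt l z := by
  simp [dt]; ring
lemma dt_sub (k l : ℤ × ℤ) (z) : dt (k - l) z = dt k z - dt l z := by
  simp [dt]; ring
lemma dt_neg (k : ℤ × ℤ) (z) : dt (-k) z = -dt k z := by
  simp [dt]; ring

lemma int_cos_cos (k l : ℤ × ℤ) : ∫ z, Real.cos (dt k z) * Real.cos (dt l z) ∂mu =
    (1 / 2) * m0 * ((if k = l then 1 else 0) + (if k = -l then 1 else 0)) := by
  have e : ∀ z, Real.cos (dt k z) * Real.cos (dt l z) =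
      (1 / 2) * (Real.cos (dt (k - l) z) + Real.cos (dt (k + l) z)) := fun z => by
    rw [dt_sub, dt_add, Real.cos_sub, Real.cos_add]; ring
  simp only [e]
  rw [integral_const_mul, integral_add (integrable_mu (cosdt_cont _))
    (integrable_mu (cosdt_cont _)), int_cos, int_cos]
  simp only [sub_eq_zero, add_eq_zero_iff_eq_neg]
  split_ifs <;> ring

/-- termwise integration against a cosine series -/
lemma int_mul_co {a} (ha : RD a) {g : ℝ × ℝ → ℝ} (hg : Continuous g) (C : ℝ) (hC : ∀ z, |g z| ≤ C) :
    ∫ z, g z * Co a z ∂mu = ∑' k, a k * ∫ z, g z * Real.cos (dt k z) ∂mu := by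
  have hc : ∀ k, Continuous fun z => a k * (g z * Real.cos (dt k z)) := fun k =>
    continuous_const.mul (hg.mul (Real.continuous_cos.comp (dt_cont k)))
  have h := hasSum_integral_of_summable_integral_norm (μ := mu)
    (F := fun k z => a k * (g z * Real.cos (dt k z))) (fun k => integrable_mu (hc k)) (by
      refine Summable.of_nonneg_of_le (fun k => integral_nonneg fun z => norm_nonneg _)
        (fun k => ?_) (ha.summable.abs.mul_right (C * m0))
      calc ∫ z, ‖a k * (g z * Real.cos (dt k z))‖ ∂mu ≤ ∫ _z, |a k| * C * 1 ∂mu := by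
            apply integral_mono (integrable_mu (hc k).norm) (integrable_const _)
            intro z
            dsimp only
            rw [Real.norm_eq_abs, abs_mul, mul_one]
            exact mul_le_mul_of_nonneg_left ((abs_mul_cos_le _ _).trans (hC z)) (abs_nonneg _)
        _ = |a k| * (C * m0) := by rw [integral_const_mul, mul_assoc, m0])
  rw [show (fun z => g z * Co a z) = fun z => ∑' k, a k * (g z * Real.cos (dt k z)) from by
    ext z; rw [Co, ← tsum_mul_left]; congr 1; ext k; ring]
  rw [← h.tsum_eq]
  congr 1; ext k
  rw [integral_const_mul]

lemma int_cos_co {a} (ha : RD a) (hev : ∀ k, a (-k) = a k) (l : ℤ × ℤ) :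
    ∫ z, Real.cos (dt l z) * Co a z ∂mu = m0 * a l := by
  rw [int_mul_co ha (cosdt_cont l) 1 (fun z => Real.abs_cos_le_one _)]
  have : ∀ k, a k * ∫ z, Real.cos (dt l z) * Real.cos (dt k z) ∂mu =
    (if k = l then (1 / 2) * m0 * a l else 0) + (if k = -l then (1 / 2) * m0 * a l else 0) := by
    intro k
    rw [int_cos_cos]
    by_cases h1 : k = l
    · subst h1
      by_cases h2 : k = -k
      · simp [← h2]; ring
      · simp [h2]; ring
    · by_cases h2 : k = -l
      · subst h2
        simp [h1, Ne.symm h1, hev]; ring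
      · have h3 : ¬ l = -k := fun h => h2 (by rw [h, neg_neg])
        simp [h1, h2, h3, Ne.symm h1]
  simp only [this]
  rw [Summable.tsum_add, tsum_ite_eq, tsum_ite_eq]
  · ring
  · exact (hasSum_ite_eq l _).summable
  · exact (hasSum_ite_eq (-l) _).summable

lemma abs_co_le {a} (ha : RD a) (z) : |Co a z| ≤ ∑' k, |a k| := by
  have := (co_summable ha z)
  calc |Co a z| ≤ ∑' k, |a k * Real.cos (dt k z)| := by
        simpa [Co] using norm_tsum_le_tsum_norm this.norm
    _ ≤ _ := this.abs.tsum_le_tsum (fun k => abs_mul_cos_le _ _) ha.summable.abs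

lemma parseval {a} (ha : RD a) (hev : ∀ k, a (-k) = a k) :
    ∫ z, Co a z * Co a z ∂mu = m0 * ∑' k, a k ^ 2 := by
  rw [int_mul_co ha (co_cont ha) _ (abs_co_le ha), ← tsum_mul_left]
  congr 1; ext k
  simp only [mul_comm (Co a _) _]
  rw [int_cos_co ha hev]; ring
end


open scoped BigOperators
open MeasureTheory
noncomputable section

/-- (l,m) ↦ (l+m,l) -/
def addEq : ((ℤ × ℤ) × (ℤ × ℤ)) ≃ ((ℤ × ℤ) × (ℤ × ℤ)) where
  toFun z := (z.1 + z.2, z.1)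
  invFun z := (z.2, z.1 - z.2)
  left_inv z := by ext <;> simp
  right_inv z := by ext <;> simp

/-- (l,m) ↦ (-l,m) -/
def negFst : ((ℤ × ℤ) × (ℤ × ℤ)) ≃ ((ℤ × ℤ) × (ℤ × ℤ)) where
  toFun z := (-z.1, z.2)
  invFun z := (-z.1, z.2)
  left_inv z := by ext <;> simp
  right_inv z := by ext <;> simp

lemma wedge_eq (l m : ℤ × ℤ) : wedge l m = (l.1 : ℝ) * m.2 - l.2 * m.1 := by
  simp [wedge]

lemma pb_inv : PB (fun k => 1 / znorm k) := by
  refine PB.of_bdd 1 fun k => ?_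
  by_cases hk : k = 0
  · subst hk; simp [znorm_zero]
  · rw [abs_div, abs_of_nonneg (znorm_nonneg k), abs_one]
    exact div_le_self zero_le_one (one_le_znorm hk)

set_option maxHeartbeats 1000000 in
lemma co_Dn {a : ℤ × ℤ → ℝ} (ha : RD a) (hev : ∀ k, a (-k) = a k) (z : ℝ × ℝ) :
    Co (Dn a) z =
      -(Si (fun k => (k.1 : ℝ) * (1 / znorm k * a k)) z * Si (fun k => (k.2 : ℝ) * a k) z
        - Si (fun k => (k.2 : ℝ) * (1 / znorm k * a k)) z * Si (fun k => (k.1 : ℝ) * a k) z) := by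
  have hcs := UD.conv_summable2 ha (Set.mem_univ 0) (fun k => Real.cos (dt k z)) 1
    (fun k => Real.abs_cos_le_one _)
  have h1s : Summable fun z : (ℤ × ℤ) × (ℤ × ℤ) => ker z.1 z.2 * a z.1 * a z.2 := by
    have := UD.conv_summable2 ha (Set.mem_univ 0) (fun k => 1) 1 (fun k => by simp)
    have := addEq.summable_iff.mpr this
    refine this.congr fun w => ?_
    simp [addEq]
  have e1 : Co (Dn a) z = ∑' w : (ℤ × ℤ) × (ℤ × ℤ),
      (1 / 2) * (ker w.1 w.2 * a w.1 * a w.2 * Real.cos (dt (w.1 + w.2) z)) := by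
    rw [tsum_mul_left]
    have : ∑' w : (ℤ × ℤ) × (ℤ × ℤ), (ker w.1 w.2 * a w.1 * a w.2 * Real.cos (dt (w.1 + w.2) z))
      = ∑' w : (ℤ × ℤ) × (ℤ × ℤ), (Real.cos (dt w.1 z)) *
          (ker w.2 (w.1 - w.2) * a w.2 * a (w.1 - w.2)) := by
      rw [← addEq.tsum_eq (fun w => Real.cos (dt w.1 z) * (ker w.2 (w.1 - w.2) * a w.2 * a (w.1 - w.2)))]
      congr 1; ext w
      simp [addEq]; ring
    rw [this, hcs.tsum_prod, ← tsum_mul_left, Co]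
    congr 1; ext k
    simp only [tsum_mul_left, Dn]
    ring
  have sG : Summable fun w : (ℤ × ℤ) × (ℤ × ℤ) =>
      (1 / 2) * ((ker w.1 w.2 * a w.1 * a w.2) * (Real.cos (dt w.1 z) * Real.cos (dt w.2 z))) := by
    refine Summable.mul_left _ (Summable.of_abs (h1s.abs.of_nonneg_of_le (fun _ => abs_nonneg _)
      (fun w => ?_)))
    rw [← mul_assoc]
    exact (abs_mul_cos_le _ _).trans (abs_mul_cos_le _ _)
  have sH : Summable fun w : (ℤ × ℤ) × (ℤ × ℤ) =>
      (1 / 2) * ((ker w.1 w.2 * a w.1 * a w.2) * (Real.sin (dt w.1 z) * Real.sin (dt w.2 z))) := by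
    refine Summable.mul_left _ (Summable.of_abs (h1s.abs.of_nonneg_of_le (fun _ => abs_nonneg _)
      (fun w => ?_)))
    rw [← mul_assoc]
    exact (abs_mul_sin_le _ _).trans (abs_mul_sin_le _ _)
  have hG0 : ∑' w : (ℤ × ℤ) × (ℤ × ℤ), (1 / 2) * ((ker w.1 w.2 * a w.1 * a w.2) *
      (Real.cos (dt w.1 z) * Real.cos (dt w.2 z))) = 0 := by
    set G := fun w : (ℤ × ℤ) × (ℤ × ℤ) => (1 / 2) * ((ker w.1 w.2 * a w.1 * a w.2) *
      (Real.cos (dt w.1 z) * Real.cos (dt w.2 z))) with hG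
    have h := negFst.tsum_eq G
    have h2 : ∀ w, G (negFst w) = -G w := fun w => by
      obtain ⟨l, m⟩ := w
      have : ker (-l) m = - ker l m := by
        simp only [ker, wedge_eq, znorm_neg, Prod.fst_neg, Prod.snd_neg]; push_cast; ring
      simp only [hG, negFst, Equiv.coe_fn_mk, this, hev, dt_neg, Real.cos_neg]
      ring
    simp only [h2, tsum_neg] at h
    linarith
  have i1 := (ha.weight (pb_inv)).weight PB.fst
  have i2 := (ha.weight (pb_inv)).weight PB.snd
  have j1 := ha.weight PB.fst
  have j2 := ha.weight PB.snd
  have sP1 := summable_mul_of_summable_norm (si_summable i1 z).norm (si_summable j2 z).norm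
  have sP2 := summable_mul_of_summable_norm (si_summable i2 z).norm (si_summable j1 z).norm
  have e2 : Si (fun k => (k.1 : ℝ) * (1 / znorm k * a k)) z * Si (fun k => (k.2 : ℝ) * a k) z
        - Si (fun k => (k.2 : ℝ) * (1 / znorm k * a k)) z * Si (fun k => (k.1 : ℝ) * a k) z =
      ∑' w : (ℤ × ℤ) × (ℤ × ℤ), (wedge w.1 w.2 * (1 / znorm w.1) * a w.1 * a w.2) *
        (Real.sin (dt w.1 z) * Real.sin (dt w.2 z)) := by
    simp only [Si]
    rw [tsum_mul_tsum_of_summable_norm (si_summable i1 z).norm (si_summable j2 z).norm,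
      tsum_mul_tsum_of_summable_norm (si_summable i2 z).norm (si_summable j1 z).norm,
      ← sP1.tsum_sub sP2]
    congr 1; ext w
    rw [wedge_eq]; ring
  have sP : Summable fun w : (ℤ × ℤ) × (ℤ × ℤ) =>
      (wedge w.1 w.2 * (1 / znorm w.1) * a w.1 * a w.2) *
        (Real.sin (dt w.1 z) * Real.sin (dt w.2 z)) := by
    refine (sP1.sub sP2).congr fun w => ?_
    rw [wedge_eq]; ring
  set P := fun w : (ℤ × ℤ) × (ℤ × ℤ) =>
      (wedge w.1 w.2 * (1 / znorm w.1) * a w.1 * a w.2) *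
        (Real.sin (dt w.1 z) * Real.sin (dt w.2 z)) with hP
  have sP' : Summable fun w : (ℤ × ℤ) × (ℤ × ℤ) => P w.swap := (Equiv.prodComm _ _).summable_iff.mpr sP
  have eP' : ∑' w : (ℤ × ℤ) × (ℤ × ℤ), P w.swap = ∑' w, P w := (Equiv.prodComm _ _).tsum_eq P
  have e3 : ∑' w : (ℤ × ℤ) × (ℤ × ℤ),
      (1 / 2) * ((ker w.1 w.2 * a w.1 * a w.2) * (Real.sin (dt w.1 z) * Real.sin (dt w.2 z))) =
      ∑' w, P w := by
    have : ∀ w : (ℤ × ℤ) × (ℤ × ℤ), (1 / 2) * ((ker w.1 w.2 * a w.1 * a w.2) *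
        (Real.sin (dt w.1 z) * Real.sin (dt w.2 z))) = (1 / 2) * (P w + P w.swap) := fun w => by
      simp only [hP, Prod.fst_swap, Prod.snd_swap, ker, wedge_swap w.1 w.2]
      ring
    simp only [this]
    rw [tsum_mul_left, sP.tsum_add sP', eP']
    ring
  rw [e2, e1, ← e3]
  have : ∀ w : (ℤ × ℤ) × (ℤ × ℤ),
      (1 / 2) * (ker w.1 w.2 * a w.1 * a w.2 * Real.cos (dt (w.1 + w.2) z)) =
      (1 / 2) * ((ker w.1 w.2 * a w.1 * a w.2) * (Real.cos (dt w.1 z) * Real.cos (dt w.2 z))) -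
      (1 / 2) * ((ker w.1 w.2 * a w.1 * a w.2) * (Real.sin (dt w.1 z) * Real.sin (dt w.2 z))) :=
    fun w => by rw [dt_add, Real.cos_add]; ring
  simp only [this]
  rw [sG.tsum_sub sH, hG0, zero_sub]

lemma si_px (a) (y : ℝ) : Si a (2 * Real.pi, y) = Si a (0, y) := by simp only [Si, sin_px]
lemma si_py (a) (x : ℝ) : Si a (x, 2 * Real.pi) = Si a (x, 0) := by simp only [Si, sin_py]
lemma co_px (a) (y : ℝ) : Co a (2 * Real.pi, y) = Co a (0, y) := by simp only [Co, cos_px]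
lemma co_py (a) (x : ℝ) : Co a (x, 2 * Real.pi) = Co a (x, 0) := by simp only [Co, cos_py]

/-- the transport term integrates to zero -/
lemma casimir_zero {a : ℤ × ℤ → ℝ} (ha : RD a) (hev : ∀ k, a (-k) = a k) {f g : ℝ → ℝ}
    (hf : ∀ y, HasDerivAt f (g y) y) (hg : Continuous g) :
    ∫ z, g (Co a z) * Co (Dn a) z ∂mu = 0 := by
  have hfc : Continuous f := continuous_iff_continuousAt.mpr fun y => (hf y).continuousAt
  set b : ℤ × ℤ → ℝ := fun k => 1 / znorm k * a k with hb
  have rb : RD b := ha.weight pb_inv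
  have i1 := rb.weight PB.fst
  have i2 := rb.weight PB.snd
  have j1 := ha.weight PB.fst
  have j2 := ha.weight PB.snd
  have i12 := i1.weight PB.snd
  have i21 := i2.weight PB.fst
  have ca := co_cont ha
  have cg : Continuous fun z => g (Co a z) := hg.comp ca
  have cf : Continuous fun z => f (Co a z) := hfc.comp ca
  have s1 := si_cont i1
  have s2 := si_cont i2
  have s3 := si_cont j1
  have s4 := si_cont j2
  have s5 := co_cont i12
  have s6 := co_cont i21
  have z1 := zero_y (G := fun z => Si (fun k => (k.1 : ℝ) * b k) z * f (Co a z))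
    (G' := fun z => Co (fun k => (k.2 : ℝ) * ((k.1 : ℝ) * b k)) z * f (Co a z) +
      Si (fun k => (k.1 : ℝ) * b k) z * (g (Co a z) * (-Si (fun k => (k.2 : ℝ) * a k) z)))
    (fun x y => (si_dy i1 x y).mul ((hf _).comp y (co_dy ha x y)))
    (by fun_prop) (fun x => by simp only [si_py, co_py])
  have z2 := zero_x (G := fun z => Si (fun k => (k.2 : ℝ) * b k) z * f (Co a z))
    (G' := fun z => Co (fun k => (k.1 : ℝ) * ((k.2 : ℝ) * b k)) z * f (Co a z) +
      Si (fun k => (k.2 : ℝ) * b k) z * (g (Co a z) * (-Si (fun k => (k.1 : ℝ) * a k) z)))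
    (fun x y => (si_dx i2 x y).mul ((hf _).comp x (co_dx ha x y)))
    (by fun_prop) (fun x => by simp only [si_px, co_px])
  have comm : (fun k : ℤ × ℤ => (k.1 : ℝ) * ((k.2 : ℝ) * b k)) =
      fun k => (k.2 : ℝ) * ((k.1 : ℝ) * b k) := by ext k; ring
  rw [comm] at z2
  have h := congrArg₂ (· - ·) z1 z2
  simp only [sub_zero] at h
  rw [← integral_sub (integrable_mu (by fun_prop)) (integrable_mu (by fun_prop))] at h
  rw [← h]
  congr 1; ext z
  rw [co_Dn ha hev z]
  ring

lemma SQGSol.co_deriv (Θ : SQGSol) (z) {t : ℝ} (ht : 0 < t) :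
    HasDerivAt (fun s => Co (Θ.θ s) z) (Co (Dn (Θ.θ t)) z) t := by
  have hT : 0 < t + 1 := by linarith
  have hu : _root_.UD (Set.Ioo 0 (t + 1)) Θ.θ := (Θ.UD hT).mono Set.Ioo_subset_Icc_self
  have hw : PB (fun k => Real.cos (dt k z)) := PB.of_bdd 1 fun k => Real.abs_cos_le_one _
  have := hasDerivAt_tsum_UD (T := t + 1) (u := fun s k => Real.cos (dt k z) * Θ.θ s k)
    (u' := fun t k => Real.cos (dt k z) * Dn (Θ.θ t) k)
    (fun k s hs => (Θ.deriv k hs.1).const_mul _) (hu.weight hw) (hu.Dn.weight hw)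
    (t := t) ⟨ht, by linarith⟩
  simp only [mul_comm (Real.cos _)] at this
  exact this

lemma SQGSol.co_cont_t (Θ : SQGSol) (z) {T : ℝ} (hT : 0 < T) :
    ContinuousOn (fun s => Co (Θ.θ s) z) (Set.Icc 0 T) := by
  obtain ⟨M, hM⟩ := (Θ.UD hT).bound
  refine continuousOn_tsum (fun k => ?_) (summable_om.mul_left M)
    (fun k s hs => (abs_mul_cos_le _ _).trans (hM s hs k))
  have : ContinuousOn (fun s => Θ.θ s k) (Set.Icc 0 T) := (Θ.cont k).mono (fun x hx => hx.1)
  exact this.mul continuousOn_const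

lemma UD.tsum_abs_le {S : Set ℝ} {u} (hu : UD S u) : ∃ M : ℝ, ∀ t ∈ S, ∑' k, |u t k| ≤ M := by
  obtain ⟨M, hM⟩ := hu.bound
  refine ⟨M * omS, fun t ht => ?_⟩
  rw [omS, ← tsum_mul_left]
  exact (hu.summable ht).abs.tsum_le_tsum (hM t ht) (summable_om.mul_left M)

/-- conservation of Casimirs -/
lemma SQGSol.casimir (Θ : SQGSol) (hev : Θ.IsEven) {f g : ℝ → ℝ}
    (hf : ∀ y, HasDerivAt f (g y) y) (hg : Continuous g) (hb : ∀ y, |g y| ≤ 1) {t : ℝ}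
    (ht : 0 ≤ t) :
    ∫ z, f (Co (Θ.θ t) z) ∂mu = ∫ z, f (Co (Θ.θ 0) z) ∂mu := by
  rcases ht.eq_or_lt with rfl | ht
  · rfl
  have hfc : Continuous f := continuous_iff_continuousAt.mpr fun y => (hf y).continuousAt
  have rd : ∀ s, 0 ≤ s → RD (Θ.θ s) := fun s hs =>
    (Θ.UD (T := s + 1) (by linarith)).RD ⟨hs, by linarith⟩
  have hlip : ∀ y, |f y| ≤ |f 0| + |y| := fun y => by
    have := Convex.norm_image_sub_le_of_norm_hasDerivWithin_le (f := f) (f' := g) (C := 1)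
      (s := Set.univ) (fun x _ => (hf x).hasDerivWithinAt) (fun x _ => hb x) convex_univ
      (Set.mem_univ 0) (Set.mem_univ y)
    simp only [Real.norm_eq_abs, one_mul, sub_zero] at this
    have h2 := abs_sub_abs_le_abs_sub (f y) (f 0)
    linarith
  have hcont : ContinuousOn (fun s => ∫ z, f (Co (Θ.θ s) z) ∂mu) (Set.Icc 0 t) := by
    obtain ⟨M, hM⟩ := (Θ.UD ht).tsum_abs_le
    refine continuousOn_of_dominated (bound := fun _ => |f 0| + M) (fun s hs => ?_) (fun s hs => ?_)
      (integrable_const _) ?_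
    · exact (hfc.comp (co_cont (rd s hs.1))).aestronglyMeasurable
    · refine Filter.Eventually.of_forall fun z => ?_
      have h1 := hlip (Co (Θ.θ s) z)
      have h2 := abs_co_le (rd s hs.1) z
      have h3 := hM s hs
      rw [Real.norm_eq_abs]; linarith
    · exact Filter.Eventually.of_forall fun z => hfc.comp_continuousOn (Θ.co_cont_t z ht)
  obtain ⟨c, hc, h⟩ := exists_hasDerivAt_eq_slope _ (fun _ => 0) ht hcont
    (fun s hs => by
      obtain ⟨M, hM⟩ := ((Θ.UD (T := s + 1) (by linarith [hs.1])).Dn).tsum_abs_le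
      have := (hasDerivAt_integral_of_dominated_loc_of_deriv_le (μ := mu) (x₀ := s)
        (s := Set.Ioo 0 (s + 1)) (F := fun s z => f (Co (Θ.θ s) z))
        (F' := fun s z => g (Co (Θ.θ s) z) * Co (Dn (Θ.θ s)) z) (bound := fun _ => M)
        (Ioo_mem_nhds hs.1 (by linarith))
        (by
          filter_upwards [Ioi_mem_nhds hs.1] with r hr
          exact (hfc.comp (co_cont (rd r (le_of_lt hr)))).aestronglyMeasurable)
        (integrable_mu (hfc.comp (co_cont (rd s hs.1.le))))
        (((hg.comp (co_cont (rd s hs.1.le))).mul (co_cont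
          ((Θ.UD (T := s + 1) (by linarith [hs.1])).Dn.RD (t := s)
            ⟨hs.1.le, by linarith⟩))).aestronglyMeasurable)
        (Filter.Eventually.of_forall fun z r hr => by
          have rm : r ∈ Set.Icc 0 (s + 1) := ⟨hr.1.le, hr.2.le⟩
          have h1 := abs_co_le ((Θ.UD (T := s + 1) (by linarith [hs.1])).Dn.RD rm) z
          have h2 := hM r rm
          rw [Real.norm_eq_abs, abs_mul]
          have h3 := hb (Co (Θ.θ r) z)
          calc _ ≤ 1 * |Co (Dn (Θ.θ r)) z| := by gcongr
            _ ≤ M := by linarith)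
        (integrable_const _)
        (Filter.Eventually.of_forall fun z r hr => (hf _).comp r (Θ.co_deriv z hr.1))).2
      rw [casimir_zero (rd s hs.1.le) (hev s hs.1.le) hf hg] at this
      exact this)
  have := (div_eq_zero_iff.mp h.symm).resolve_right (by linarith)
  linarith
end


open scoped BigOperators
open MeasureTheory
noncomputable section

lemma abs_sin_nat_le (n : ℕ) (x : ℝ) : |Real.sin (n * x)| ≤ n * |Real.sin x| := by
  induction n with
  | zero => simp
  | succ n ih =>
    push_cast
    rw [add_mul, one_mul, Real.sin_add]
    calc |Real.sin (n * x) * Real.cos x + Real.cos (n * x) * Real.sin x|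
        ≤ |Real.sin (n * x) * Real.cos x| + |Real.cos (n * x) * Real.sin x| := abs_add_le _ _
      _ ≤ |Real.sin (n * x)| + |Real.sin x| := by
          refine add_le_add (abs_mul_cos_le _ _) ?_
          rw [mul_comm]; exact abs_mul_cos_le _ _
      _ ≤ _ := by linarith

lemma abs_cos_nat_sub_le (n : ℕ) (x y : ℝ) :
    |Real.cos (n * x) - Real.cos (n * y)| ≤ n ^ 2 * |Real.cos x - Real.cos y| := by
  rw [Real.cos_sub_cos, Real.cos_sub_cos, ← mul_add, ← mul_sub, mul_div_assoc, mul_div_assoc,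
    abs_mul, abs_mul, abs_mul, abs_mul]
  have h1 := abs_sin_nat_le n ((x + y) / 2)
  have h2 := abs_sin_nat_le n ((x - y) / 2)
  have := mul_le_mul h1 h2 (abs_nonneg _) (by positivity)
  norm_num
  nlinarith

/-- Chebyshev-type function -/
def gn (n : ℕ) (y : ℝ) : ℝ := Real.cos (n * Real.arccos (y / 2))

lemma gn_cont (n : ℕ) : Continuous (gn n) := by
  unfold gn
  exact Real.continuous_cos.comp (continuous_const.mul
    (Real.continuous_arccos.comp (continuous_id.div_const 2)))

lemma cos_arccos_lip (x y : ℝ) :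
    |Real.cos (Real.arccos x) - Real.cos (Real.arccos y)| ≤ |x - y| := by
  have key : ∀ x, Real.cos (Real.arccos x) = max (-1) (min 1 x) := fun x => by
    rcases le_total x (-1) with h | h
    · rw [Real.arccos_of_le_neg_one h, Real.cos_pi, min_eq_right (by linarith), max_eq_left h]
    · rcases le_total 1 x with h' | h'
      · rw [Real.arccos_of_one_le h', Real.cos_zero, min_eq_left h', max_eq_right (by norm_num)]
      · rw [Real.cos_arccos h h', min_eq_right h', max_eq_right h]
  rw [key, key]
  calc _ ≤ |min 1 x - min 1 y| := abs_max_sub_max_le_abs _ _ _ |> fun h => by simpa [max_comm] using h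
    _ ≤ _ := by
      have := abs_min_sub_min_le_max 1 x 1 y
      simpa using this

lemma gn_lip (n : ℕ) (x y : ℝ) : |gn n x - gn n y| ≤ n ^ 2 / 2 * |x - y| := by
  unfold gn
  refine (abs_cos_nat_sub_le n _ _).trans ?_
  have h := cos_arccos_lip (x / 2) (y / 2)
  rw [← sub_div, abs_div, abs_of_pos (by norm_num : (0:ℝ) < 2)] at h
  have := mul_le_mul_of_nonneg_left h (by positivity : (0:ℝ) ≤ (n:ℝ) ^ 2)
  linarith

lemma gn_two_cos (n : ℕ) (x : ℝ) : gn n (2 * Real.cos x) = Real.cos (n * x) := by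
  unfold gn
  rw [mul_div_cancel_left₀ _ (by norm_num : (2:ℝ) ≠ 0)]
  have h1 := Polynomial.Chebyshev.T_real_cos (Real.arccos (Real.cos x)) n
  have h2 := Polynomial.Chebyshev.T_real_cos x n
  rw [Real.cos_arccos (Real.neg_one_le_cos x) (Real.cos_le_one x), h2] at h1
  exact_mod_cast h1.symm

def fn (n : ℕ) (y : ℝ) : ℝ := ∫ x in (0:ℝ)..y, gn n x

lemma fn_deriv (n : ℕ) (y : ℝ) : HasDerivAt (fn n) (gn n y) y :=
  (gn_cont n).integral_hasStrictDerivAt 0 y |>.hasDerivAt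

lemma fn_cont (n : ℕ) : Continuous (fn n) :=
  continuous_iff_continuousAt.mpr fun y => (fn_deriv n y).continuousAt

lemma fn_taylor (n : ℕ) (a b : ℝ) :
    |fn n (a + b) - fn n a - gn n a * b| ≤ n ^ 2 / 2 * (b * b) := by
  have h0 : fn n (a + b) - fn n a - gn n a * b = ∫ x in a..(a + b), (gn n x - gn n a) := by
    rw [intervalIntegral.integral_sub ((gn_cont n).intervalIntegrable _ _) (by simp)]
    unfold fn
    rw [intervalIntegral.integral_interval_sub_left ((gn_cont n).intervalIntegrable _ _)
      ((gn_cont n).intervalIntegrable _ _)]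
    simp; ring
  rw [h0]
  have := intervalIntegral.norm_integral_le_of_norm_le_const (a := a) (b := a + b)
    (f := fun x => gn n x - gn n a) (C := n ^ 2 / 2 * |b|) (fun x hx => by
      rw [Real.norm_eq_abs]
      refine (gn_lip n x a).trans ?_
      refine mul_le_mul_of_nonneg_left ?_ (by positivity)
      have := Set.abs_sub_left_of_mem_uIcc (Set.uIoc_subset_uIcc hx)
      simpa using this)
  rw [Real.norm_eq_abs] at this
  refine this.trans (le_of_eq ?_)
  rw [add_sub_cancel_left, mul_assoc, abs_mul_abs_self]

lemma RD.of_finite {a : ℤ × ℤ → ℝ} (h : (Function.support a).Finite) : RD a := fun N => by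
  obtain ⟨M, hM⟩ := (h.image (fun k => (1 + znorm k) ^ N * |a k|)).bddAbove
  refine ⟨max M 0, fun t _ k => ?_⟩
  by_cases hk : a k = 0
  · simp [hk]
  · exact (hM ⟨k, hk, rfl⟩).trans (le_max_left _ _)

lemma pdat_support (τ : ℝ) : Function.support (pdat τ) ⊆
    (({(1, 0), (-1, 0), (0, 2), (0, -2), (1, 2), (-1, -2)} : Finset (ℤ × ℤ)) : Set (ℤ × ℤ)) := by
  intro k hk
  simp only [Function.mem_support, pdat] at hk
  simp only [Finset.coe_insert, Finset.coe_singleton, Set.mem_insert_iff, Set.mem_singleton_iff]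
  by_contra hh
  push Not at hh
  simp [hh] at hk

lemma pdat_finite (τ : ℝ) : (Function.support (pdat τ)).Finite :=
  (Finset.finite_toSet _).subset (pdat_support τ)

lemma pdat_even (τ : ℝ) (k : ℤ × ℤ) : pdat τ (-k) = pdat τ k := by
  obtain ⟨x, y⟩ := k
  unfold pdat
  simp only [Prod.neg_mk, Prod.mk.injEq]
  congr 1
  · apply propext; omega
  · congr 1; apply propext; omega

lemma tsum_pdat (τ : ℝ) (F : ℤ × ℤ → ℝ → ℝ) (hF : ∀ k, F k 0 = 0) :
    ∑' k, F k (pdat τ k) = F (1, 0) 1 + F (-1, 0) 1 + F (0, 2) τ + F (0, -2) τ + F (1, 2) τ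
      + F (-1, -2) τ := by
  rw [tsum_eq_sum (s := ({(1, 0), (-1, 0), (0, 2), (0, -2), (1, 2), (-1, -2)} : Finset (ℤ × ℤ)))]
  · rw [Finset.sum_insert (by decide), Finset.sum_insert (by decide), Finset.sum_insert (by decide),
      Finset.sum_insert (by decide), Finset.sum_insert (by decide), Finset.sum_singleton]
    simp [pdat]; ring
  · intro k hk
    have : pdat τ k = 0 := by
      by_contra h
      exact hk (by have := pdat_support τ h; exact_mod_cast this)
    rw [this, hF]

lemma co_pdat0 (z : ℝ × ℝ) : Co (pdat 0) z = 2 * Real.cos z.1 := by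
  unfold Co
  rw [tsum_pdat 0 (fun k x => x * Real.cos (dt k z)) (by simp)]
  simp [dt]; ring

lemma cas_est {d : ℤ × ℤ → ℝ} (hd : RD d) (hev : ∀ k, d (-k) = d k) (n : ℕ) :
    |∫ z, fn n (Co (fun k => pdat 0 k + d k) z) ∂mu - ∫ z, fn n (Co (pdat 0) z) ∂mu
      - m0 * d (n, 0)| ≤ n ^ 2 / 2 * (m0 * ∑' k, d k ^ 2) := by
  have hc : RD (pdat 0) := RD.of_finite (pdat_finite 0)
  have e1 : ∀ z, Co (fun k => pdat 0 k + d k) z = Co (pdat 0) z + Co d z := fun z => by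
    simp only [Co, add_mul]
    exact (co_summable hc z).tsum_add (co_summable hd z)
  have e2 : ∫ z, gn n (Co (pdat 0) z) * Co d z ∂mu = m0 * d (n, 0) := by
    rw [← int_cos_co hd hev]
    congr 1; ext z
    rw [co_pdat0, gn_two_cos]
    simp [dt]
  simp only [e1]
  have c1 : Continuous fun z => fn n (Co (pdat 0) z + Co d z) :=
    (fn_cont n).comp ((co_cont hc).add (co_cont hd))
  have c2 : Continuous fun z => fn n (Co (pdat 0) z) := (fn_cont n).comp (co_cont hc)
  have c3 : Continuous fun z => gn n (Co (pdat 0) z) * Co d z :=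
    ((gn_cont n).comp (co_cont hc)).mul (co_cont hd)
  have c4 : Continuous fun z => Co d z * Co d z := (co_cont hd).mul (co_cont hd)
  have c5 : Continuous fun z => fn n (Co (pdat 0) z + Co d z) - fn n (Co (pdat 0) z) := c1.sub c2
  rw [← e2, ← parseval hd hev, ← integral_sub (integrable_mu c1) (integrable_mu c2),
    ← integral_sub (integrable_mu c5) (integrable_mu c3), ← integral_const_mul]
  refine (abs_integral_le_integral_abs).trans ?_
  refine integral_mono (integrable_mu (c5.sub c3).abs)
    (integrable_mu (continuous_const.mul c4)) fun z => ?_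
  exact fn_taylor n _ _

lemma SQGSol.RD (Θ : SQGSol) {t : ℝ} (ht : 0 ≤ t) : RD (Θ.θ t) :=
  (Θ.UD (T := t + 1) (by linarith)).RD ⟨ht, by linarith⟩

lemma RD.sub {a b} (ha : RD a) (hb : RD b) : RD (fun k => a k - b k) := by
  have := UD.add ha (UD.weight hb (PB.const (-1)))
  simpa [RD, sub_eq_add_neg] using this

/-- smallness of the shear modes -/
lemma SQGSol.shear (Θ : SQGSol) (hev : Θ.IsEven) {τ : ℝ} (h0 : ∀ k, Θ.θ 0 k = pdat τ k)
    {t : ℝ} (ht : 0 ≤ t) {n : ℕ} (hn : 2 ≤ n) :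
    |Θ.θ t (n, 0)| ≤ n ^ 2 / 2 * (∑' k, (Θ.θ t k - pdat 0 k) ^ 2 + 4 * τ ^ 2) := by
  have hc : _root_.RD (pdat 0) := RD.of_finite (pdat_finite 0)
  have key : ∀ s, 0 ≤ s → |∫ z, fn n (Co (Θ.θ s) z) ∂mu - ∫ z, fn n (Co (pdat 0) z) ∂mu
      - m0 * Θ.θ s (n, 0)| ≤ n ^ 2 / 2 * (m0 * ∑' k, (Θ.θ s k - pdat 0 k) ^ 2) := fun s hs => by
    have := cas_est ((Θ.RD hs).sub hc) (fun k => by rw [hev s hs, pdat_even]) n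
    have hz : pdat 0 ((n : ℤ), 0) = 0 := by
      have h1 : (n : ℤ) ≠ 1 := by omega
      have h2 : (n : ℤ) ≠ -1 := by omega
      simp [pdat, h1, h2]
    simpa [hz] using this
  have k1 := key t ht
  have k0 := key 0 le_rfl
  rw [Θ.casimir hev (fn_deriv n) (gn_cont n) (fun y => Real.abs_cos_le_one _) ht] at k1
  have s0 : ∑' k, (Θ.θ 0 k - pdat 0 k) ^ 2 = 4 * τ ^ 2 := by
    have : ∀ k, (Θ.θ 0 k - pdat 0 k) ^ 2 =
      (fun (k : ℤ × ℤ) (x : ℝ) => if k = (1, 0) ∨ k = (-1, 0) then 0 else x ^ 2) k (pdat τ k) := by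
      intro k
      rw [h0]
      by_cases h : k = (1, 0) ∨ k = (-1, 0)
      · simp [pdat, h]
      · simp [pdat, h]
    simp only [this]
    rw [tsum_pdat τ (fun (k : ℤ × ℤ) (x : ℝ) => if k = (1, 0) ∨ k = (-1, 0) then 0 else x ^ 2)
      (by intro k; split_ifs <;> simp)]
    simp; ring
  have z0 : Θ.θ 0 (n, 0) = 0 := by
    rw [h0]
    have h1 : (n : ℤ) ≠ 1 := by omega
    have h2 : (n : ℤ) ≠ -1 := by omega
    simp [pdat, h1, h2]
  rw [s0, z0] at k0
  have hm := m0_pos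
  have : m0 * |Θ.θ t (n, 0)| ≤ m0 * (n ^ 2 / 2 * (∑' k, (Θ.θ t k - pdat 0 k) ^ 2 + 4 * τ ^ 2)) := by
    rw [← abs_of_pos hm, ← abs_mul, abs_of_pos hm]
    rw [abs_le] at *
    constructor <;> nlinarith
  exact le_of_mul_le_mul_left this hm
end


open scoped BigOperators
open MeasureTheory
noncomputable section

def phi (k : ℤ × ℤ) : ℝ := 1 - 1 / znorm k

/-- the perturbation: remove the modes ±e -/
def pp (a : ℤ × ℤ → ℝ) (k : ℤ × ℤ) : ℝ := if k = (1, 0) ∨ k = (-1, 0) then 0 else a k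

lemma znorm_e : znorm (1, 0) = 1 := by simp [znorm]
lemma znorm_ne : znorm (-1, 0) = 1 := by simp [znorm]

lemma ker_comm (l m : ℤ × ℤ) : ker m l = ker l m := by
  unfold ker; rw [wedge_swap]; ring

lemma RD.of_le {a b : ℤ × ℤ → ℝ} (ha : RD a) (h : ∀ k, |b k| ≤ |a k|) : RD b := fun N => by
  obtain ⟨M, hM⟩ := ha N
  refine ⟨M, fun t ht k => le_trans ?_ (hM t ht k)⟩
  have := znorm_nonneg k
  exact mul_le_mul_of_nonneg_left (h k) (by positivity)

lemma RD.pp {a} (ha : RD a) : RD (pp a) := ha.of_le fun k => by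
  unfold _root_.pp; split_ifs <;> simp

lemma RD.mul {a b} (ha : RD a) (hb : RD b) : RD (fun k => a k * b k) := UD.mul ha hb
lemma RD.add {a b} (ha : RD a) (hb : RD b) : RD (fun k => a k + b k) := UD.add ha hb
lemma RD.shift {a} (ha : RD a) (j) : RD (fun k => a (k + j)) := UD.shift ha j
lemma RD.Dn {a} (ha : RD a) : RD (Dn a) := UD.Dn ha

lemma pb_phi : PB phi := by
  refine ((PB.const 1).add ((PB.const (-1)).mul pb_inv)).imp fun C h => ?_
  simpa [phi, sub_eq_add_neg] using h

lemma Dn_decomp {a : ℤ × ℤ → ℝ} (ha : RD a) (hev : ∀ k, a (-k) = a k) {k : ℤ × ℤ}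
    (hk : k.2 ≠ 0) :
    Dn a k = a (1, 0) * (k.2 * (phi (k + (-1, 0)) * a (k + (-1, 0))
      - phi (k + (1, 0)) * a (k + (1, 0)))) + Dn (pp a) k := by
  have hne : a (-1, 0) = a (1, 0) := by simpa using hev (1, 0)
  set X := k.2 * phi (k + (-1, 0)) * a (k + (-1, 0)) * a (1, 0) with hX
  set X' := -k.2 * phi (k + (1, 0)) * a (k + (1, 0)) * a (1, 0) with hX'
  have k1 : ker (1, 0) (k + (-1, 0)) = k.2 * phi (k + (-1, 0)) := by
    simp [ker, wedge_eq, phi, znorm_e]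
  have k2 : ker (-1, 0) (k + (1, 0)) = -k.2 * phi (k + (1, 0)) := by
    simp [ker, wedge_eq, phi, znorm_ne]
  have hpt : ∀ l, ker l (k - l) * a l * a (k - l) = ker l (k - l) * pp a l * pp a (k - l) +
      (((if l = (1, 0) then X else 0) + (if l = (-1, 0) then X' else 0)) +
      ((if l = k + (-1, 0) then X else 0) + (if l = k + (1, 0) then X' else 0))) := by
    intro l
    have hs1 : k - (1, 0) = k + (-1, 0) := by ext <;> simp <;> ring
    have hs2 : k - (-1, 0) = k + (1, 0) := by ext <;> simp
    have n1 : k + (-1, 0) ≠ (1, 0) := fun h => hk (by simpa using congrArg Prod.snd h)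
    have n2 : k + (-1, 0) ≠ (-1, 0) := fun h => hk (by simpa using congrArg Prod.snd h)
    have n3 : k + (1, 0) ≠ (1, 0) := fun h => hk (by simpa using congrArg Prod.snd h)
    have n4 : k + (1, 0) ≠ (-1, 0) := fun h => hk (by simpa using congrArg Prod.snd h)
    have n5 : k + (1, 0) ≠ k + (-1, 0) := fun h => by simpa using congrArg Prod.fst (add_left_cancel h)
    by_cases h1 : l = (1, 0)
    · subst h1
      rw [hs1, k1]
      simp [pp, n1.symm, n3.symm, hX]
      ring
    by_cases h2 : l = (-1, 0)
    · subst h2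
      rw [hs2, k2]
      simp [pp, n2.symm, n4.symm, hX', hne]
      ring
    by_cases h3 : l = k + (-1, 0)
    · subst h3
      have : k - (k + (-1, 0)) = (1, 0) := by ext <;> simp
      rw [this, ker_comm, k1]
      simp only [pp, h1, h2, n5.symm, if_true, if_false, hX, true_or, or_false]
      ring
    by_cases h4 : l = k + (1, 0)
    · subst h4
      have : k - (k + (1, 0)) = (-1, 0) := by ext <;> simp
      rw [this, ker_comm, k2]
      simp only [pp, h1, h2, h3, if_true, if_false, hX', or_true, or_false, hne]
      ring
    have h5 : k - l ≠ (1, 0) := fun h => h3 (by rw [← hs1, ← h]; abel)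
    have h6 : k - l ≠ (-1, 0) := fun h => h4 (by rw [← hs2, ← h]; abel)
    simp [pp, h1, h2, h3, h4, h5, h6]
  have s0 : Summable fun l => ker l (k - l) * pp a l * pp a (k - l) :=
    UD.conv_summable ha.pp (Set.mem_univ 0) k
  have hs := s0.hasSum.add (((hasSum_ite_eq (1, 0) X).add (hasSum_ite_eq (-1, 0) X')).add
    ((hasSum_ite_eq (k + (-1, 0)) X).add (hasSum_ite_eq (k + (1, 0)) X')))
  unfold Dn
  simp only [hpt]
  rw [hs.tsum_eq, hX, hX']
  ring

/-- `c k = (1+|k|²)^{-2}` -/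
def cc (k : ℤ × ℤ) : ℝ := ((1 + znorm k ^ 2) ^ 2)⁻¹

lemma cc_pos (k) : 0 < cc k := by unfold cc; positivity
lemma cc_le (k) : cc k ≤ 1 := by
  unfold cc; apply inv_le_one_of_one_le₀; nlinarith [sq_nonneg (znorm k), sq_nonneg (znorm k ^2)]

lemma pb_cc : PB cc := PB.of_bdd 1 fun k => by rw [abs_of_pos (cc_pos k)]; exact cc_le k

/-- `w k = k₂ k₁ (φ_{k+e} - φ_{k-e})` -/
def ww (k : ℤ × ℤ) : ℝ := k.2 * k.1 * (phi (k + (1, 0)) - phi (k + (-1, 0)))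

lemma ww_lower {k : ℤ × ℤ} (hk : 2 ≤ k.2) : 2 * k.2 * k.1 ^ 2 * cc k ≤ ww k := by
  have h2 : (2:ℝ) ≤ k.2 := by exact_mod_cast hk
  have n1 : k + (1, 0) ≠ 0 := fun h => by
    have := congrArg Prod.snd h
    simp at this; omega
  have n2 : k + (-1, 0) ≠ 0 := fun h => by
    have := congrArg Prod.snd h
    simp at this; omega
  have hB := znorm_pos n1
  have hA := znorm_pos n2
  have hB2 := znorm_sq (k + (1, 0))
  have hA2 := znorm_sq (k + (-1, 0))
  have hq := znorm_sq k
  set B := znorm (k + (1, 0))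
  set A := znorm (k + (-1, 0))
  simp only [Prod.fst_add, Prod.snd_add, Int.cast_add, Int.cast_one, Int.cast_neg, add_zero] at hA2 hB2
  unfold ww phi cc
  rw [hq]
  set x : ℝ := (k.1 : ℝ)
  set y : ℝ := (k.2 : ℝ)
  set q : ℝ := 1 + (x ^ 2 + y ^ 2) with hqdef
  have hq1 : 1 ≤ q := by rw [hqdef]; nlinarith [sq_nonneg x, sq_nonneg y]
  have hAB : A * B ≤ q := by nlinarith [sq_nonneg (A - B)]
  have hApB : A + B ≤ 2 * q := by
    apply abs_le_of_sq_le_sq' _ (by linarith) |>.2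
    nlinarith [sq_nonneg (A - B)]
  have hprod : A * B * (A + B) ≤ 2 * q ^ 2 := by
    calc A * B * (A + B) ≤ q * (2 * q) := by gcongr
      _ = _ := by ring
  have e : y * x * (1 - 1 / B - (1 - 1 / A)) = y * (4 * x ^ 2) / (A * B * (A + B)) := by
    have : 4 * x = (B - A) * (B + A) := by nlinarith
    field_simp
    linear_combination (-x) * this
  rw [e, ← div_eq_mul_inv, div_le_div_iff₀ (by positivity) (by positivity)]
  have h0 : 0 ≤ y * x ^ 2 := by positivity
  nlinarith [mul_le_mul_of_nonneg_left hprod h0]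

lemma phi_ge {k : ℤ × ℤ} (hk : 2 ≤ znorm k) : 1 / 2 ≤ phi k := by
  unfold phi
  have : 1 / znorm k ≤ 1 / 2 := one_div_le_one_div_of_le (by norm_num) hk
  linarith

lemma phi_le (k) : phi k ≤ 1 := by
  unfold phi; have := znorm_nonneg k; have : 0 ≤ 1 / znorm k := by positivity
  linarith

lemma phi_nonneg (k) : 0 ≤ phi k := by
  unfold phi
  by_cases hk : k = 0
  · subst hk; simp [znorm_zero]
  · have := one_le_znorm hk
    have : 1 / znorm k ≤ 1 := by rw [div_le_one (by linarith)]; exact this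
    linarith

lemma two_le_znorm {k : ℤ × ℤ} (hk : 2 ≤ |k.2|) : 2 ≤ znorm k := by
  refine le_trans ?_ (abs_snd_le k)
  exact_mod_cast hk

def XX (ψ : ℤ × ℤ → ℝ) (k : ℤ × ℤ) : ℝ := (k.1 + 1 / 2) *
  (phi k * (ψ (k + (-1, 0)) - ψ (k + (1, 0))) * ψ (k + (1, 0))
    + phi (k + (1, 0)) * ψ k * (ψ k - ψ (k + (2, 0))))

def YY (ψ : ℤ × ℤ → ℝ) (k : ℤ × ℤ) : ℝ :=
  k.1 * (phi (k + (1, 0)) - phi (k + (-1, 0))) * ψ k ^ 2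
    + 1 / 2 * phi k * (ψ (k + (-1, 0)) + ψ (k + (1, 0))) ^ 2

def WW (ψ : ℤ × ℤ → ℝ) (k : ℤ × ℤ) : ℝ :=
  -(k.1 - 1 / 2) * phi (k + (-1, 0)) * (ψ k * ψ k)
  - (k.1 - 1 / 2) * phi k * (ψ (k + (-1, 0)) * ψ (k + (1, 0)))
  + 1 / 2 * phi k * (ψ (k + (-1, 0)) * ψ (k + (-1, 0))) - 1 / 2 * phi (k + (-1, 0)) * (ψ k * ψ k)

lemma XX_eq (ψ : ℤ × ℤ → ℝ) (k : ℤ × ℤ) : XX ψ k = YY ψ k + WW ψ (k + (1, 0)) - WW ψ k := by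
  have h1 : k + (1, 0) + (-1, 0) = k := by ext <;> simp
  have h2 : k + (1, 0) + (1, 0) = k + (2, 0) := by ext <;> simp; ring
  unfold XX YY WW
  rw [h1, h2]
  simp only [Prod.fst_add, Int.cast_add, Int.cast_one]
  ring

def tt (ψ : ℤ × ℤ → ℝ) (k : ℤ × ℤ) : ℝ := if k.1 = 2 then 1 / 2 * ww k * (ψ k * ψ k) else 0
def ss (ψ : ℤ × ℤ → ℝ) (k : ℤ × ℤ) : ℝ := if k.1 = 0 then cc k * (ψ k * ψ k) else 0

lemma YY_lower (ψ : ℤ × ℤ → ℝ) {k : ℤ × ℤ} (hk : 2 ≤ k.2) :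
    cc k * ψ k ^ 2 + tt ψ k - tt ψ (k + (1, 0)) - ss ψ k + ss ψ (k + (-1, 0)) ≤ k.2 * YY ψ k := by
  have h2 : (2:ℝ) ≤ k.2 := by exact_mod_cast hk
  have hw := ww_lower hk
  have hc := cc_pos k
  have hφ : 1 / 2 ≤ phi k := phi_ge (two_le_znorm (hk.trans (le_abs_self _)))
  have hY : k.2 * YY ψ k = ww k * ψ k ^ 2
      + 1 / 2 * (k.2 * phi k) * (ψ (k + (-1, 0)) + ψ (k + (1, 0))) ^ 2 := by
    unfold YY ww; ring
  have hkφ : 1 ≤ k.2 * phi k := by nlinarith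
  have hsq := sq_nonneg (ψ (k + (-1, 0)) + ψ (k + (1, 0)))
  have hsk := sq_nonneg (ψ k)
  rw [hY]
  by_cases h0 : k.1 = 0
  · have : ww k = 0 := by simp [ww, h0]
    simp [tt, ss, h0, this]
    nlinarith
  have hk1 : (1:ℝ) ≤ (k.1:ℝ) ^ 2 := by
    have : (1:ℤ) ≤ k.1 ^ 2 := by have := sq_pos_of_ne_zero h0 (R := ℤ) (a := k.1); omega
    exact_mod_cast this
  have hw4 : 4 * (k.1:ℝ) ^ 2 * cc k ≤ ww k := by
    refine le_trans ?_ hw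
    gcongr
    linarith
  have hw1 : 4 * cc k ≤ ww k := by
    refine le_trans ?_ hw4
    nlinarith
  by_cases h1 : k.1 = 1
  · obtain ⟨k1, k2⟩ := k
    simp only at h1 hk h2 hw4 hw1 ⊢
    subst h1
    simp only [tt, ss, Prod.mk_add_mk, add_zero] at *
    norm_num at *
    have hw2 := ww_lower (k := (2, k2)) hk
    have hc02 : 4 * cc (0, k2) ≤ ww (2, k2) := by
      refine le_trans ?_ hw2
      unfold cc
      rw [znorm_sq, znorm_sq]
      push_cast
      rw [← div_eq_mul_inv, ← div_eq_mul_inv, div_le_div_iff₀ (by positivity) (by positivity)]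
      have : (1 + (2 ^ 2 + (k2:ℝ) ^ 2)) ≤ 9 / 5 * (1 + (0 ^ 2 + (k2:ℝ) ^ 2)) := by nlinarith
      calc 4 * (1 + (2 ^ 2 + (k2:ℝ) ^ 2)) ^ 2 ≤ 4 * (9 / 5 * (1 + (0 ^ 2 + (k2:ℝ) ^ 2))) ^ 2 := by
            gcongr
        _ ≤ 16 * (1 + (0 ^ 2 + (k2:ℝ) ^ 2)) ^ 2 := by nlinarith [sq_nonneg (1 + (0 ^ 2 + (k2:ℝ) ^ 2))]
        _ ≤ _ := by gcongr; linarith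
    have hc0 := cc_pos (0, k2)
    have hc01 : cc (0, k2) ≤ 1 / 4 := by
      unfold cc
      rw [znorm_sq, ← one_div]
      apply one_div_le_one_div_of_le (by norm_num)
      push_cast
      nlinarith
    set u := ψ (0, k2)
    set v := ψ (2, k2)
    have e1 : cc (0, k2) * (u * u) ≤ cc (0, k2) * (2 * (u + v) ^ 2 + 2 * v ^ 2) := by
      gcongr
      nlinarith [sq_nonneg (u + 2 * v)]
    nlinarith [mul_le_mul_of_nonneg_right hc02 (sq_nonneg v),
      mul_le_mul_of_nonneg_right hc01 hsq, mul_le_mul_of_nonneg_right hkφ hsq,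
      mul_le_mul_of_nonneg_right hw1 hsk]
  have e3 : tt ψ (k + (1, 0)) = 0 := by
    unfold tt; rw [if_neg]; simp; omega
  have e4 : ss ψ (k + (-1, 0)) = 0 := by
    unfold ss; rw [if_neg]; simp; omega
  have e5 : ss ψ k = 0 := by simp [ss, h0]
  have e6 : tt ψ k ≤ 1 / 2 * ww k * ψ k ^ 2 := by
    unfold tt; split_ifs
    · rw [pow_two]
    · have : 0 ≤ ww k := by linarith
      positivity
  rw [e3, e4, e5]
  nlinarith [mul_le_mul_of_nonneg_right hw1 hsk, mul_le_mul_of_nonneg_right hkφ hsq]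

end


open scoped BigOperators
open MeasureTheory
noncomputable section

lemma RD.ite {a} (ha : RD a) (p : ℤ × ℤ → Prop) [DecidablePred p] :
    RD (fun k => if p k then a k else 0) := ha.of_le fun k => by
  split_ifs <;> simp

lemma RD.congr {a b : ℤ × ℤ → ℝ} (ha : RD a) (h : ∀ k, a k = b k) : RD b :=
  ha.of_le fun k => by rw [h]

lemma pb_ww : PB ww := by
  refine ((PB.snd.mul PB.fst).mul ((pb_phi.shift (1, 0)).add
    ((PB.const (-1)).mul (pb_phi.shift (-1, 0))))).imp fun C h => ?_
  simpa [ww, sub_eq_add_neg] using h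

lemma RD.WW {ψ} (hψ : RD ψ) : RD (WW ψ) := by
  have f1 : PB fun k => -((k.1:ℝ) + (-1 / 2)) := by
    refine ((PB.const (-1)).mul (PB.fst.add (PB.const (-1 / 2)))).imp fun C h => ?_
    simpa using h
  have f2 := pb_phi.shift (-1, 0)
  have s1 := hψ.shift (-1, 0)
  have s2 := hψ.shift (1, 0)
  refine (((((hψ.mul hψ).weight (f1.mul f2)).add ((s1.mul s2).weight (f1.mul pb_phi))).add
    ((s1.mul s1).weight ((PB.const (1 / 2)).mul pb_phi))).add
    ((hψ.mul hψ).weight ((PB.const (-1 / 2)).mul f2))).congr fun k => ?_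
  unfold _root_.WW
  ring

lemma RD.tt {ψ} (hψ : RD ψ) : RD (tt ψ) := by
  refine (((hψ.mul hψ).weight ((PB.const (1 / 2)).mul pb_ww)).ite (fun k => k.1 = 2)).congr
    fun k => ?_
  rfl

lemma RD.ss {ψ} (hψ : RD ψ) : RD (ss ψ) :=
  (((hψ.mul hψ).weight pb_cc).ite (fun k => k.1 = 0)).congr fun k => rfl

lemma tsum_shift_sub {U : ℤ × ℤ → ℝ} (hU : RD U) (j : ℤ × ℤ) : ∑' k, (U (k + j) - U k) = 0 := by
  rw [(hU.shift j).summable.tsum_sub hU.summable]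
  have := (Equiv.addRight j).tsum_eq U
  simp only [Equiv.coe_addRight] at this
  linarith

lemma RD.kXX {ψ} (hψ : RD ψ) : RD (fun k => if 2 ≤ k.2 then k.2 * XX ψ k else 0) := by
  have f1 : PB fun k => (k.2:ℝ) * ((k.1:ℝ) + (1 / 2)) := PB.snd.mul (PB.fst.add (PB.const (1 / 2)))
  have s1 := hψ.shift (-1, 0)
  have s2 := hψ.shift (1, 0)
  have s3 := hψ.shift (2, 0)
  refine ((((((s1.mul s2).add ((s2.mul s2).weight (PB.const (-1)))).weight pb_phi).add
    (((hψ.mul hψ).add ((hψ.mul s3).weight (PB.const (-1)))).weight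
      (pb_phi.shift (1, 0)))).weight f1).ite (fun k => 2 ≤ k.2)).congr fun k => ?_
  unfold XX
  split_ifs <;> ring

lemma lin_lower {ψ : ℤ × ℤ → ℝ} (hψ : RD ψ) :
    ∑' k : ℤ × ℤ, (if 2 ≤ k.2 then cc k * ψ k ^ 2 else 0) ≤
      ∑' k : ℤ × ℤ, (if 2 ≤ k.2 then k.2 * XX ψ k else 0) := by
  set U : ℤ × ℤ → ℝ := fun k => if 2 ≤ k.2 then k.2 * WW ψ k - tt ψ k - ss ψ (k + (-1, 0)) else 0
    with hU
  have rU : RD U := by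
    refine ((((hψ.WW.weight PB.snd).add (hψ.tt.weight (PB.const (-1)))).add
      ((hψ.ss.shift (-1, 0)).weight (PB.const (-1)))).ite (fun k => 2 ≤ k.2)).congr fun k => ?_
    simp only [hU]
    split_ifs <;> ring
  have rc : RD (fun k : ℤ × ℤ => if 2 ≤ k.2 then cc k * ψ k ^ 2 else 0) := by
    refine (((hψ.mul hψ).weight pb_cc).ite (fun k => 2 ≤ k.2)).congr fun k => ?_
    simp only [pow_two]
  have h0 := tsum_shift_sub rU (1, 0)
  have sU : Summable fun k => U (k + (1, 0)) - U k := (rU.shift (1, 0)).summable.sub rU.summable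
  calc _ = ∑' k : ℤ × ℤ, ((if 2 ≤ k.2 then cc k * ψ k ^ 2 else 0) + (U (k + (1, 0)) - U k)) := by
        rw [rc.summable.tsum_add sU, h0, add_zero]
    _ ≤ _ := by
      refine (rc.summable.add sU).tsum_le_tsum (fun k => ?_) hψ.kXX.summable
      by_cases hk : 2 ≤ k.2
      · have h1 : k + (1, 0) + (-1, 0) = k := by ext <;> simp
        have := YY_lower ψ hk
        simp only [hU, hk, if_true, Prod.snd_add, add_zero, XX_eq, h1]
        nlinarith
      · simp [hU, hk]

/-- weight of the monotone functional -/
def Phi (k : ℤ × ℤ) : ℝ := if 2 ≤ k.2 then phi k * phi (k + (1, 0)) * (k.1 + 1 / 2) else 0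

lemma pb_Phi : PB Phi :=
  (((pb_phi.mul (pb_phi.shift (1, 0))).mul (PB.fst.add (PB.const (1 / 2)))).ite (fun k => 2 ≤ k.2))

def Err (a : ℤ × ℤ → ℝ) : ℝ := ∑' k, Phi k * (Dn (pp a) k * a (k + (1, 0)) + a k * Dn (pp a) (k + (1, 0)))

lemma J_lower {a : ℤ × ℤ → ℝ} (ha : RD a) (hev : ∀ k, a (-k) = a k) (h0 : 0 ≤ a (1, 0)) :
    a (1, 0) * ∑' k : ℤ × ℤ, (if 2 ≤ k.2 then cc k * (phi k * a k) ^ 2 else 0) + Err a ≤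
      ∑' k, Phi k * (Dn a k * a (k + (1, 0)) + a k * Dn a (k + (1, 0))) := by
  have hψ : RD (fun k => phi k * a k) := ha.weight pb_phi
  have rE : RD fun k => Phi k * (Dn (pp a) k * a (k + (1, 0)) + a k * Dn (pp a) (k + (1, 0))) :=
    ((ha.pp.Dn.mul (ha.shift (1, 0))).add (ha.mul (ha.pp.Dn.shift (1, 0)))).weight pb_Phi
  have hpt : ∀ k, Phi k * (Dn a k * a (k + (1, 0)) + a k * Dn a (k + (1, 0))) =
      a (1, 0) * (if 2 ≤ k.2 then k.2 * XX (fun k => phi k * a k) k else 0) +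
      Phi k * (Dn (pp a) k * a (k + (1, 0)) + a k * Dn (pp a) (k + (1, 0))) := by
    intro k
    by_cases hk : 2 ≤ k.2
    · have h1 : k + (1, 0) + (-1, 0) = k := by ext <;> simp
      have h2 : k + (1, 0) + (1, 0) = k + (2, 0) := by ext <;> simp; ring
      rw [Dn_decomp ha hev (k := k) (by omega), Dn_decomp ha hev (k := k + (1, 0)) (by simp; omega),
        h1, h2]
      simp only [Phi, hk, if_true, XX, Prod.snd_add, add_zero]
      ring
    · simp [Phi, hk]
  simp only [hpt]
  rw [(hψ.kXX.summable.mul_left _).tsum_add rE.summable, tsum_mul_left, Err]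
  have := mul_le_mul_of_nonneg_left (lin_lower hψ) h0
  linarith
end


open scoped BigOperators
open MeasureTheory
noncomputable section

lemma RD.sq {a} (ha : RD a) : RD (fun k => a k ^ 2) := (ha.mul ha).congr fun k => (pow_two _).symm

lemma PB.pow {w} (hw : PB w) (n : ℕ) : PB (fun k => w k ^ n) := by
  induction n with
  | zero => simpa using PB.const 1
  | succ n ih => simpa [pow_succ] using ih.mul hw

lemma RD.znsq {a} (ha : RD a) (n : ℕ) : Summable (fun k => znorm k ^ n * a k ^ 2) :=
  (ha.sq.weight (PB.znorm.pow n)).summable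

lemma mom_le {a : ℤ × ℤ → ℝ} (ha : RD a) {σ D₀ D₁ : ℝ} (h0 : 0 ≤ σ)
    (H0 : ∑' k, a k ^ 2 ≤ D₀ * σ ^ 22)
    (H1 : ∑' k, znorm k ^ 22 * a k ^ 2 ≤ D₁) {j : ℕ} (hj : j ≤ 22) :
    σ ^ j * ∑' k, znorm k ^ j * a k ^ 2 ≤ (D₀ + D₁) * σ ^ 22 := by
  rw [← tsum_mul_left]
  calc ∑' k, σ ^ j * (znorm k ^ j * a k ^ 2)
      ≤ ∑' k, (a k ^ 2 + σ ^ 22 * (znorm k ^ 22 * a k ^ 2)) := by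
        refine ((ha.znsq j).mul_left _).tsum_le_tsum (fun k => ?_)
          (ha.sq.summable.add ((ha.znsq 22).mul_left _))
        have hx : 0 ≤ σ * znorm k := mul_nonneg h0 (znorm_nonneg k)
        have : (σ * znorm k) ^ j ≤ 1 + (σ * znorm k) ^ 22 := by
          rcases le_total (σ * znorm k) 1 with h | h
          · have := pow_le_one₀ (n := j) hx h
            have := pow_nonneg hx 22
            linarith
          · have := pow_le_pow_right₀ h hj
            linarith
        rw [mul_pow, mul_pow] at this
        nlinarith [mul_le_mul_of_nonneg_right this (sq_nonneg (a k))]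
    _ = ∑' k, a k ^ 2 + σ ^ 22 * ∑' k, (znorm k ^ 22 * a k ^ 2) := by
        rw [ha.sq.summable.tsum_add ((ha.znsq 22).mul_left _), tsum_mul_left]
    _ ≤ _ := by
        have := mul_le_mul_of_nonneg_left H1 (pow_nonneg h0 22)
        linarith

lemma Dn_le {q : ℤ × ℤ → ℝ} (hq : RD q) {σ D : ℝ} (h0 : 0 < σ)
    (H0 : ∑' k, q k ^ 2 ≤ D * σ ^ 22) (H2 : σ ^ 2 * ∑' k, znorm k ^ 2 * q k ^ 2 ≤ D * σ ^ 22)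
    (k : ℤ × ℤ) : |Dn q k| ≤ D * σ ^ 21 := by
  set F : ℤ × ℤ → ℝ := fun l => σ * (znorm l ^ 2 * q l ^ 2) + σ⁻¹ * q l ^ 2 with hF
  have sF : Summable F := ((hq.znsq 2).mul_left _).add (hq.sq.summable.mul_left _)
  have sF' : Summable fun l => F (k - l) := (Equiv.subLeft k).summable_iff.mpr sF
  have eF' : ∑' l, F (k - l) = ∑' l, F l := (Equiv.subLeft k).tsum_eq F
  have hpt : ∀ l, |ker l (k - l) * q l * q (k - l)| ≤ (1 / 2) * (F l + F (k - l)) := fun l => by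
    rw [abs_mul, abs_mul]
    set m := k - l
    have hk := abs_ker_le l m
    have a1 := abs_nonneg (q l)
    have a2 := abs_nonneg (q m)
    have : |ker l m| * |q l| * |q m| ≤ (znorm l + znorm m) * |q l| * |q m| := by gcongr
    refine this.trans ?_
    have key : ∀ x y : ℝ, x * y ≤ (1 / 2) * (σ * x ^ 2 + σ⁻¹ * y ^ 2) := fun x y => by
      have : 0 ≤ σ⁻¹ * (σ * x - y) ^ 2 := by positivity
      have e : σ⁻¹ * (σ * x - y) ^ 2 = σ * x ^ 2 + σ⁻¹ * y ^ 2 - 2 * (x * y) := by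
        field_simp; ring
      linarith
    have b1 := key (znorm l * |q l|) |q m|
    have b2 := key (znorm m * |q m|) |q l|
    simp only [mul_pow, sq_abs] at b1 b2
    simp only [hF]
    linarith
  have hs : Summable fun l => ker l (k - l) * q l * q (k - l) :=
    UD.conv_summable hq (Set.mem_univ 0) k
  have h1 : |∑' l, ker l (k - l) * q l * q (k - l)| ≤ ∑' l, F l := by
    calc _ ≤ ∑' l, |ker l (k - l) * q l * q (k - l)| := by
          simpa using norm_tsum_le_tsum_norm hs.norm
      _ ≤ ∑' l, (1 / 2) * (F l + F (k - l)) :=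
          hs.abs.tsum_le_tsum hpt ((sF.add sF').mul_left _)
      _ = _ := by rw [tsum_mul_left, sF.tsum_add sF', eF']; ring
  have h2 : ∑' l, F l ≤ 2 * D * σ ^ 21 := by
    rw [hF, ((hq.znsq 2).mul_left _).tsum_add (hq.sq.summable.mul_left _), tsum_mul_left,
      tsum_mul_left]
    have e1 : σ * ∑' k, znorm k ^ 2 * q k ^ 2 ≤ D * σ ^ 21 := by
      refine le_of_mul_le_mul_left ?_ h0
      calc _ = σ ^ 2 * ∑' k, znorm k ^ 2 * q k ^ 2 := by ring
        _ ≤ _ := H2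
        _ = _ := by ring
    have e2 : σ⁻¹ * ∑' k, q k ^ 2 ≤ D * σ ^ 21 := by
      refine le_of_mul_le_mul_left ?_ h0
      rw [mul_inv_cancel_left₀ h0.ne']
      calc _ ≤ _ := H0
        _ = _ := by ring
    linarith
  unfold Dn
  rw [abs_mul, abs_of_pos (by norm_num : (0:ℝ) < 1 / 2)]
  linarith

lemma sum_abs_le {q : ℤ × ℤ → ℝ} (hq : RD q) {σ D : ℝ} (h0 : 0 < σ)
    (H6 : σ ^ 6 * ∑' k, znorm k ^ 6 * q k ^ 2 ≤ D * σ ^ 22) :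
    ∑' k, znorm k * |q k| ≤ σ ^ 8 * (8 * omS + D / 2) := by
  have sL : Summable fun k => znorm k * |q k| := by
    have := (hq.weight PB.znorm).summable.abs
    refine this.congr fun k => ?_
    rw [abs_mul, abs_of_nonneg (znorm_nonneg k)]
  have hpt : ∀ k, znorm k * |q k| ≤
      8 * σ ^ 8 * om k + (2 * σ ^ 8)⁻¹ * (znorm k ^ 6 * q k ^ 2) := fun k => by
    by_cases hk : k = 0
    · subst hk
      have := om_pos 0
      simp [znorm_zero]; positivity
    · have h1 := one_le_znorm hk
      have hom := inv_pow_le_om k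
      have h2 : (znorm k ^ 4)⁻¹ ≤ 16 * om k := by
        refine le_trans ?_ (mul_le_mul_of_nonneg_left hom (by norm_num))
        rw [← div_eq_mul_inv, inv_eq_one_div, div_le_div_iff₀ (by positivity) (by positivity)]
        have : (1 + znorm k) ^ 4 ≤ (2 * znorm k) ^ 4 := by gcongr; linarith
        nlinarith
      have h3 : znorm k * |q k| ≤ 1 / 2 * σ ^ 8 * (znorm k ^ 4)⁻¹
          + (2 * σ ^ 8)⁻¹ * (znorm k ^ 6 * q k ^ 2) := by
        rw [← sq_abs (q k)]
        have hz : 0 < znorm k := by linarith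
        set z := znorm k
        set y := |q k|
        have e : 1 / 2 * σ ^ 8 * (z ^ 4)⁻¹ + (2 * σ ^ 8)⁻¹ * (z ^ 6 * y ^ 2) - z * y =
          (2 * σ ^ 8)⁻¹ * (z ^ 4)⁻¹ * (σ ^ 8 - z ^ 5 * y) ^ 2 := by field_simp; ring
        have : 0 ≤ (2 * σ ^ 8)⁻¹ * (z ^ 4)⁻¹ * (σ ^ 8 - z ^ 5 * y) ^ 2 := by positivity
        linarith
      have := mul_le_mul_of_nonneg_left h2 (by positivity : (0:ℝ) ≤ 1 / 2 * σ ^ 8)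
      linarith
  have s1 := (summable_om.mul_left (8 * σ ^ 8))
  have s2 := ((hq.znsq 6).mul_left ((2 * σ ^ 8)⁻¹))
  calc _ ≤ _ := sL.tsum_le_tsum hpt (s1.add s2)
    _ = 8 * σ ^ 8 * omS + (2 * σ ^ 8)⁻¹ * ∑' k, znorm k ^ 6 * q k ^ 2 := by
        rw [s1.tsum_add s2, tsum_mul_left, tsum_mul_left, omS]
    _ ≤ 8 * σ ^ 8 * omS + (2 * σ ^ 8)⁻¹ * (D * σ ^ 16) := by
        gcongr
        refine le_of_mul_le_mul_left ?_ (pow_pos h0 6)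
        calc _ ≤ _ := H6
          _ = _ := by ring
    _ = _ := by field_simp

lemma pp_of_snd {a : ℤ × ℤ → ℝ} {k : ℤ × ℤ} (hk : k.2 ≠ 0) : pp a k = a k := by
  unfold pp
  rw [if_neg]
  rintro (h | h) <;> exact hk (by rw [h])

lemma abs_Phi_le (k) : |Phi k| ≤ 2 * znorm k ∧ |Phi k| ≤ 2 * znorm (k + (1, 0)) := by
  unfold Phi
  split_ifs with hk
  · have n1 : k ≠ 0 := fun h => by rw [h] at hk; simp at hk
    have n2 : k + (1, 0) ≠ 0 := fun h => by
      have := congrArg Prod.snd h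
      simp at this; omega
    have b : |phi k * phi (k + (1, 0)) * (k.1 + 1 / 2)| ≤ |(k.1:ℝ) + 1 / 2| := by
      rw [abs_mul]
      refine mul_le_of_le_one_left (abs_nonneg _) ?_
      rw [abs_of_nonneg (mul_nonneg (phi_nonneg _) (phi_nonneg _))]
      exact mul_le_one₀ (phi_le _) (phi_nonneg _) (phi_le _)
    have c1 : |(k.1:ℝ) + 1 / 2| ≤ |(k.1:ℝ)| + 1 / 2 := by
      refine (abs_add_le _ _).trans ?_
      norm_num
    have c2 : |(k.1:ℝ) + 1 / 2| ≤ |((k + (1, 0)).1:ℝ)| + 1 / 2 := by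
      have : (k.1:ℝ) + 1 / 2 = ((k + (1, 0)).1:ℝ) - 1 / 2 := by
        simp only [Prod.fst_add]; push_cast; ring
      rw [this]
      refine (abs_sub _ _).trans ?_
      norm_num
    have := abs_fst_le k
    have := abs_fst_le (k + (1, 0))
    have := one_le_znorm n1
    have := one_le_znorm n2
    constructor <;> linarith
  · have := znorm_nonneg k
    have := znorm_nonneg (k + (1, 0))
    simp; constructor <;> linarith

lemma Err_le {a : ℤ × ℤ → ℝ} (ha : RD a) {C S : ℝ} (hC : 0 ≤ C) (hN : ∀ k, |Dn (pp a) k| ≤ C)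
    (hS : ∑' k, znorm k * |pp a k| ≤ S) : |Err a| ≤ 4 * C * S := by
  have rE : RD fun k => Phi k * (Dn (pp a) k * a (k + (1, 0)) + a k * Dn (pp a) (k + (1, 0))) :=
    ((ha.pp.Dn.mul (ha.shift (1, 0))).add (ha.mul (ha.pp.Dn.shift (1, 0)))).weight pb_Phi
  have sL : Summable fun k => znorm k * |pp a k| := by
    have := (ha.pp.weight PB.znorm).summable.abs
    refine this.congr fun k => ?_
    rw [abs_mul, abs_of_nonneg (znorm_nonneg k)]
  have sL' : Summable fun k : ℤ × ℤ => znorm (k + (1, 0)) * |pp a (k + (1, 0))| :=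
    (Equiv.addRight ((1, 0) : ℤ × ℤ)).summable_iff (f := fun k => znorm k * |pp a k|) |>.mpr sL
  have eL' : ∑' k, znorm (k + (1, 0)) * |pp a (k + (1, 0))| = ∑' k, znorm k * |pp a k| :=
    (Equiv.addRight ((1, 0) : ℤ × ℤ)).tsum_eq (fun k => znorm k * |pp a k|)
  calc |Err a| ≤ ∑' k, |Phi k * (Dn (pp a) k * a (k + (1, 0)) + a k * Dn (pp a) (k + (1, 0)))| := by
        simpa [Err] using norm_tsum_le_tsum_norm rE.summable.norm
    _ ≤ ∑' k, 2 * C * (znorm (k + (1, 0)) * |pp a (k + (1, 0))| + znorm k * |pp a k|) := by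
        refine rE.summable.abs.tsum_le_tsum (fun k => ?_) ((sL'.add sL).mul_left _)
        by_cases hk : 2 ≤ k.2
        · rw [pp_of_snd (a := a) (k := k) (by omega), pp_of_snd (a := a) (k := k + (1, 0)) (by simp; omega)]
          obtain ⟨p1, p2⟩ := abs_Phi_le k
          have n1 := hN k
          have n2 := hN (k + (1, 0))
          rw [mul_add]
          refine (abs_add_le _ _).trans ?_
          rw [abs_mul, abs_mul, abs_mul, abs_mul]
          have q1 : |Phi k| * (|Dn (pp a) k| * |a (k + (1, 0))|) ≤
              2 * znorm (k + (1, 0)) * (C * |a (k + (1, 0))|) := by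
            have := znorm_nonneg (k + (1, 0))
            exact mul_le_mul p2 (mul_le_mul_of_nonneg_right n1 (abs_nonneg _)) (by positivity) (by positivity)
          have q2 : |Phi k| * (|a k| * |Dn (pp a) (k + (1, 0))|) ≤
              2 * znorm k * (|a k| * C) := by
            have := znorm_nonneg k
            exact mul_le_mul p1 (mul_le_mul_of_nonneg_left n2 (abs_nonneg _)) (by positivity) (by positivity)
          linarith
        · have := znorm_nonneg k
          have := znorm_nonneg (k + (1, 0))
          simp only [Phi, hk, if_false, zero_mul, abs_zero]
          positivity
    _ = 4 * C * ∑' k, znorm k * |pp a k| := by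
        rw [tsum_mul_left, sL'.tsum_add sL, eL']; ring
    _ ≤ _ := by gcongr

lemma cc_sum_lower {a : ℤ × ℤ → ℝ} (ha : RD a) {R G B2 : ℝ} (hR : 1 ≤ R)
    (hG : G ≤ ∑' k : ℤ × ℤ, (if 2 ≤ k.2 then a k ^ 2 else 0))
    (hB : ∑' k, znorm k ^ 22 * a k ^ 2 ≤ B2) :
    (16 * R ^ 4)⁻¹ * (G - (R ^ 22)⁻¹ * B2) ≤
      ∑' k : ℤ × ℤ, (if 2 ≤ k.2 then cc k * (phi k * a k) ^ 2 else 0) := by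
  have s1 : Summable fun k : ℤ × ℤ => (if 2 ≤ k.2 then a k ^ 2 else 0) :=
    (ha.sq.ite (fun k => 2 ≤ k.2)).summable
  have s2 := (ha.znsq 22).mul_left ((R ^ 22)⁻¹)
  have s3 : Summable fun k : ℤ × ℤ => (if 2 ≤ k.2 then cc k * (phi k * a k) ^ 2 else 0) :=
    (((ha.weight pb_phi).sq.weight pb_cc).ite (fun k => 2 ≤ k.2)).summable
  calc _ ≤ (16 * R ^ 4)⁻¹ * (∑' k : ℤ × ℤ, (if 2 ≤ k.2 then a k ^ 2 else 0) -
          (R ^ 22)⁻¹ * ∑' k, znorm k ^ 22 * a k ^ 2) := by gcongr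
    _ = ∑' k : ℤ × ℤ, (16 * R ^ 4)⁻¹ * ((if 2 ≤ k.2 then a k ^ 2 else 0) -
          (R ^ 22)⁻¹ * (znorm k ^ 22 * a k ^ 2)) := by
        rw [tsum_mul_left, s1.tsum_sub s2, tsum_mul_left]
    _ ≤ _ := by
      refine ((s1.sub s2).mul_left _).tsum_le_tsum (fun k => ?_) s3
      have hz := znorm_nonneg k
      by_cases hk : 2 ≤ k.2
      · simp only [hk, if_true]
        have hφ : 1 / 2 ≤ phi k := phi_ge (two_le_znorm (hk.trans (le_abs_self _)))
        have hφ2 : 1 / 4 * a k ^ 2 ≤ (phi k * a k) ^ 2 := by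
          rw [mul_pow]
          gcongr
          nlinarith
        have hc := cc_pos k
        rcases le_total (znorm k) R with h | h
        · have hcl : (4 * R ^ 4)⁻¹ ≤ cc k := by
            unfold cc
            apply inv_anti₀ (by positivity)
            have : 1 + znorm k ^ 2 ≤ 2 * R ^ 2 := by nlinarith
            calc (1 + znorm k ^ 2) ^ 2 ≤ (2 * R ^ 2) ^ 2 := by gcongr
              _ = _ := by ring
          calc _ ≤ (16 * R ^ 4)⁻¹ * (a k ^ 2) := by
                gcongr
                have : 0 ≤ (R ^ 22)⁻¹ * (znorm k ^ 22 * a k ^ 2) := by positivity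
                linarith
            _ = (4 * R ^ 4)⁻¹ * (1 / 4 * a k ^ 2) := by field_simp; ring
            _ ≤ _ := by gcongr
        · refine le_trans ?_ (by positivity : 0 ≤ cc k * (phi k * a k) ^ 2)
          refine mul_nonpos_of_nonneg_of_nonpos (by positivity) ?_
          have : 1 ≤ (R ^ 22)⁻¹ * znorm k ^ 22 := by
            rw [← div_eq_inv_mul, one_le_div (by positivity)]
            gcongr
          nlinarith [sq_nonneg (a k)]
      · simp only [hk, if_false, zero_sub]
        have : 0 ≤ (R ^ 22)⁻¹ * (znorm k ^ 22 * a k ^ 2) := by positivity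
        refine mul_nonpos_of_nonneg_of_nonpos (by positivity) (by linarith)
end


open scoped BigOperators
open MeasureTheory
noncomputable section

lemma split_sum {a w : ℤ × ℤ → ℝ} (ha : RD a) (hev : ∀ k, a (-k) = a k) (hw : PB w) :
    ∑' k, w k * a k ^ 2 = (w (1, 0) + w (-1, 0)) * a (1, 0) ^ 2 + ∑' k, w k * pp a k ^ 2 := by
  have hne : a (-1, 0) = a (1, 0) := by simpa using hev (1, 0)
  have hpt : ∀ k, w k * a k ^ 2 = w k * pp a k ^ 2 +
      ((if k = (1, 0) then w (1, 0) * a (1, 0) ^ 2 else 0) +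
       (if k = (-1, 0) then w (-1, 0) * a (1, 0) ^ 2 else 0)) := fun k => by
    by_cases h1 : k = (1, 0)
    · subst h1; simp [pp]
    · by_cases h2 : k = (-1, 0)
      · subst h2; simp [pp, hne]
      · simp [pp, h1, h2]
  have s := (ha.pp.sq.weight hw).summable.hasSum.add
    ((hasSum_ite_eq (1, 0) (w (1, 0) * a (1, 0) ^ 2)).add
      (hasSum_ite_eq (-1, 0) (w (-1, 0) * a (1, 0) ^ 2)))
  rw [tsum_congr hpt, s.tsum_eq]; ring

lemma pp_support {a : ℤ × ℤ → ℝ} (h0 : a 0 = 0) (hodd : ∀ k : ℤ × ℤ, Odd k.2 → a k = 0) {k : ℤ × ℤ}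
    (hk : pp a k ≠ 0) : 2 ≤ znorm k := by
  unfold pp at hk
  split_ifs at hk with h
  · exact absurd rfl hk
  · push Not at h
    have hev : ¬ Odd k.2 := fun h' => hk (hodd k h')
    have hne : k ≠ 0 := fun h' => hk (by rw [h', h0])
    by_cases h2 : k.2 = 0
    · refine le_trans ?_ (abs_fst_le k)
      have : 2 ≤ |k.1| := by
        by_contra hlt
        have : k.1 = 0 ∨ k.1 = 1 ∨ k.1 = -1 := by
          rw [not_le, abs_lt] at hlt; omega
        rcases this with h1 | h1 | h1
        · exact hne (Prod.ext h1 h2)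
        · exact h.1 (Prod.ext h1 h2)
        · exact h.2 (Prod.ext h1 h2)
      exact_mod_cast this
    · apply two_le_znorm
      by_contra hlt
      rw [not_le, abs_lt] at hlt
      have : k.2 = 1 ∨ k.2 = -1 := by omega
      rcases this with h1 | h1 <;> exact hev (by rw [h1]; decide)

lemma mass_eq (Θ : SQGSol) (hev : Θ.IsEven)
    {τ : ℝ} (h0 : ∀ k, Θ.θ 0 k = pdat τ k) {t : ℝ} (ht : 0 ≤ t) :
    2 * Θ.θ t (1, 0) ^ 2 + ∑' k, pp (Θ.θ t) k ^ 2 = 2 + 4 * τ ^ 2 := by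
  have h := Θ.conserved hev 1 0 ht
  have h1 := split_sum (w := fun _ => 1) (Θ.RD ht) (hev t ht) (PB.const 1)
  simp only [zero_div, add_zero, one_mul, h0, ← pow_two] at h h1
  rw [h1, tsum_pdat τ (fun _ x => x ^ 2) (by simp)] at h
  linarith

lemma pert_bounds (Θ : SQGSol) (hev : Θ.IsEven)
    (hodd : ∀ t : ℝ, 0 ≤ t → ∀ k : ℤ × ℤ, Odd k.2 → Θ.θ t k = 0)
    {τ : ℝ} (h0 : ∀ k, Θ.θ 0 k = pdat τ k) {t : ℝ} (ht : 0 ≤ t) :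
    2 * τ ^ 2 ≤ ∑' k, pp (Θ.θ t) k ^ 2 ∧ ∑' k, pp (Θ.θ t) k ^ 2 ≤ 6 * τ ^ 2 := by
  have h := Θ.conserved hev 1 (-1) ht
  have h1 := split_sum (w := phi) (Θ.RD ht) (hev t ht) pb_phi
  have hφ : ∀ k, 1 + -1 / znorm k = phi k := fun k => by unfold phi; ring
  simp only [hφ, h0, ← pow_two] at h
  rw [h1, tsum_pdat τ (fun k x => phi k * x ^ 2) (by simp)] at h
  have z1 : phi (1, 0) = 0 := by simp [phi, znorm_e]
  have z2 : phi (-1, 0) = 0 := by simp [phi, znorm_ne]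
  have z3 : phi (0, 2) = 1 / 2 := by
    have : znorm (0, 2) = 2 := by
      unfold znorm; norm_num
    rw [phi, this]; norm_num
  have z4 : phi (0, -2) = 1 / 2 := by
    rw [← z3]; have := znorm_neg (0, 2); simp only [phi, ← this]; norm_num
  have z5 : phi (-1, -2) = phi (1, 2) := by
    have := znorm_neg (1, 2); simp only [phi, ← this]; norm_num
  have z6 : 1 / 2 ≤ phi (1, 2) := phi_ge (two_le_znorm (by norm_num))
  have z7 := phi_le (1, 2)
  rw [z1, z2, z3, z4, z5] at h
  have hq := (Θ.RD ht).pp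
  have sq := hq.sq.summable
  have sp := (hq.sq.weight pb_phi).summable
  have b1 : ∑' k, phi k * pp (Θ.θ t) k ^ 2 ≤ ∑' k, pp (Θ.θ t) k ^ 2 :=
    sp.tsum_le_tsum (fun k => mul_le_of_le_one_left (sq_nonneg _) (phi_le k)) sq
  have b2 : ∑' k, 1 / 2 * pp (Θ.θ t) k ^ 2 ≤ ∑' k, phi k * pp (Θ.θ t) k ^ 2 := by
    refine (sq.mul_left _).tsum_le_tsum (fun k => ?_) sp
    by_cases hk : pp (Θ.θ t) k = 0
    · simp [hk]
    · have := phi_ge (pp_support (Θ.zero_mode t ht) (hodd t ht) hk)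
      gcongr
  rw [tsum_mul_left] at b2
  have := sq_nonneg τ
  constructor <;> nlinarith

lemma h_bounds (Θ : SQGSol) (hev : Θ.IsEven)
    (hodd : ∀ t : ℝ, 0 ≤ t → ∀ k : ℤ × ℤ, Odd k.2 → Θ.θ t k = 0)
    {τ : ℝ} (h0 : ∀ k, Θ.θ 0 k = pdat τ k) (hτ : τ ^ 2 ≤ 1 / 4) {t : ℝ} (ht : 0 ≤ t) :
    1 / 2 ≤ Θ.θ t (1, 0) ∧ (Θ.θ t (1, 0) - 1) ^ 2 ≤ τ ^ 2 := by
  have key : ∀ s, 0 ≤ s → 1 - τ ^ 2 ≤ Θ.θ s (1, 0) ^ 2 ∧ Θ.θ s (1, 0) ^ 2 ≤ 1 + τ ^ 2 :=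
    fun s hs => by
    have h1 := mass_eq Θ hev h0 hs
    have h2 := pert_bounds Θ hev hodd h0 hs
    constructor <;> linarith
  have hpos : 0 < Θ.θ t (1, 0) := by
    by_contra hneg
    have hc : ContinuousOn (fun s => Θ.θ s (1, 0)) (Set.Icc 0 t) :=
      (Θ.cont (1, 0)).mono Set.Icc_subset_Ici_self
    have h1 : Θ.θ 0 (1, 0) = 1 := by rw [h0]; simp [pdat]
    have := intermediate_value_Icc' ht hc ⟨not_lt.mp hneg, by rw [h1]; norm_num⟩
    obtain ⟨s, hs, hs0⟩ := this
    have := (key s hs.1).1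
    simp only at hs0
    rw [hs0] at this
    linarith
  obtain ⟨k1, k2⟩ := key t ht
  set h := Θ.θ t (1, 0)
  constructor
  · nlinarith
  · have : (h - 1) ^ 2 * (h + 1) ^ 2 ≤ (τ ^ 2) ^ 2 := by
      have : (h - 1) ^ 2 * (h + 1) ^ 2 = (h ^ 2 - 1) ^ 2 := by ring
      rw [this]
      apply sq_le_sq'
      · linarith
      · linarith
    have h3 : (h - 1) ^ 2 ≤ (h - 1) ^ 2 * (h + 1) ^ 2 := by
      apply le_mul_of_one_le_right (sq_nonneg _); nlinarith
    nlinarith [sq_nonneg τ]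

lemma shear_le (Θ : SQGSol) (hev : Θ.IsEven)
    (hodd : ∀ t : ℝ, 0 ≤ t → ∀ k : ℤ × ℤ, Odd k.2 → Θ.θ t k = 0)
    {τ : ℝ} (h0 : ∀ k, Θ.θ 0 k = pdat τ k) (hτ : τ ^ 2 ≤ 1 / 4) {t : ℝ} (ht : 0 ≤ t) {n : ℕ} (hn : 2 ≤ n) :
    |Θ.θ t (n, 0)| ≤ 6 * n ^ 2 * τ ^ 2 := by
  have h := Θ.shear hev h0 ht hn
  have hb := h_bounds Θ hev hodd h0 hτ ht
  have hp := pert_bounds Θ hev hodd h0 ht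
  have hc : RD (pdat 0) := RD.of_finite (pdat_finite 0)
  have h1 := split_sum (w := fun _ => 1) ((Θ.RD ht).sub hc)
    (fun k => by rw [hev t ht, pdat_even]) (PB.const 1)
  have e : ∀ k, pp (fun k => Θ.θ t k - pdat 0 k) k = pp (Θ.θ t) k := fun k => by
    unfold pp
    split_ifs with h'
    · rfl
    · simp [pdat, h']
  simp only [e, one_mul] at h1
  rw [h1] at h
  have e1 : pdat 0 (1, 0) = 1 := by simp [pdat]
  rw [e1] at h
  refine h.trans ?_
  have : (n:ℝ) ^ 2 / 2 * ((1 + 1) * (Θ.θ t (1, 0) - 1) ^ 2 + ∑' k, pp (Θ.θ t) k ^ 2 + 4 * τ ^ 2)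
      ≤ (n:ℝ) ^ 2 / 2 * (12 * τ ^ 2) := by
    refine mul_le_mul_of_nonneg_left ?_ (by positivity)
    linarith
  linarith


lemma upper_half {a : ℤ × ℤ → ℝ} (ha : RD a) (hev : ∀ k, a (-k) = a k)
    (hodd : ∀ k : ℤ × ℤ, Odd k.2 → a k = 0) :
    ∑' k, pp a k ^ 2 = 2 * ∑' k : ℤ × ℤ, (if 2 ≤ k.2 then a k ^ 2 else 0) +
      ∑' k : ℤ × ℤ, (if k.2 = 0 then pp a k ^ 2 else 0) := by
  have s1 : Summable fun k : ℤ × ℤ => (if 2 ≤ k.2 then a k ^ 2 else 0) :=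
    (ha.sq.ite (fun k => 2 ≤ k.2)).summable
  have s2 : Summable fun k : ℤ × ℤ => (if k.2 = 0 then pp a k ^ 2 else 0) :=
    (ha.pp.sq.ite (fun k => k.2 = 0)).summable
  have s3 : Summable fun k : ℤ × ℤ => (if 2 ≤ (-k).2 then a (-k) ^ 2 else 0) :=
    (Equiv.neg (ℤ × ℤ)).summable_iff (f := fun k : ℤ × ℤ => (if 2 ≤ k.2 then a k ^ 2 else 0)) |>.mpr s1
  have e3 : ∑' k : ℤ × ℤ, (if 2 ≤ (-k).2 then a (-k) ^ 2 else 0) =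
      ∑' k : ℤ × ℤ, (if 2 ≤ k.2 then a k ^ 2 else 0) :=
    (Equiv.neg (ℤ × ℤ)).tsum_eq (fun k : ℤ × ℤ => (if 2 ≤ k.2 then a k ^ 2 else 0))
  have hpt : ∀ k, pp a k ^ 2 = ((if 2 ≤ k.2 then a k ^ 2 else 0) +
      (if 2 ≤ (-k).2 then a (-k) ^ 2 else 0)) + (if k.2 = 0 then pp a k ^ 2 else 0) := fun k => by
    rw [hev k]
    by_cases h0 : k.2 = 0
    · simp [h0]
    · rw [pp_of_snd h0]
      by_cases h1 : k.2 = 1 ∨ k.2 = -1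
      · have : a k = 0 := hodd k (by rcases h1 with h | h <;> rw [h] <;> decide)
        simp [this]
      · by_cases h2 : 2 ≤ k.2
        · have : ¬ 2 ≤ (-k).2 := by simp; omega
          simp only [h2, this, h0, if_true, if_false]; ring
        · have : 2 ≤ (-k).2 := by simp; omega
          simp only [h2, this, h0, if_true, if_false]; ring
  rw [tsum_congr hpt, (s1.add s3).tsum_add s2, s1.tsum_add s3, e3]
  ring

lemma shear_sum {a : ℤ × ℤ → ℝ} (ha : RD a) (hev : ∀ k, a (-k) = a k) (h0 : a 0 = 0) {C : ℝ}
    (hs : ∀ n : ℕ, 2 ≤ n → n * |a (n, 0)| ≤ C) :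
    ∑' k : ℤ × ℤ, (if k.2 = 0 then pp a k ^ 2 else 0) ≤ 4 * C ^ 2 * omS := by
  rw [omS, ← tsum_mul_left]
  refine (ha.pp.sq.ite (fun k => k.2 = 0)).summable.tsum_le_tsum (fun k => ?_) (summable_om.mul_left _)
  have hom := (om_pos k).le
  by_cases h2 : k.2 = 0
  swap
  · simp only [h2, if_false]; positivity
  simp only [h2, if_true]
  by_cases hp : pp a k = 0
  · rw [hp]; simp; positivity
  have hn : 2 ≤ k.1.natAbs := by
    by_contra hlt
    have : k.1 = 0 ∨ k.1 = 1 ∨ k.1 = -1 := by omega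
    apply hp
    rcases this with h1 | h1 | h1
    · rw [show k = 0 from Prod.ext h1 h2]; simp [pp, h0]
    · rw [show k = (1, 0) from Prod.ext h1 h2]; simp [pp]
    · rw [show k = (-1, 0) from Prod.ext h1 h2]; simp [pp]
  have hb := hs _ hn
  have hak : |pp a k| ≤ |a (k.1.natAbs, 0)| := by
    have : |pp a k| ≤ |a k| := by unfold pp; split_ifs <;> simp
    refine this.trans (le_of_eq ?_)
    rcases Int.natAbs_eq k.1 with h | h
    · rw [← h, show (k.1, (0:ℤ)) = k from Prod.ext rfl h2.symm]
    · rw [← hev k]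
      congr 2
      refine Prod.ext ?_ ?_
      · simp only [Prod.fst_neg]; omega
      · simp [h2]
  have hn' : (2:ℝ) ≤ (k.1.natAbs : ℝ) := by exact_mod_cast hn
  have habs : |(k.1:ℝ)| = (k.1.natAbs : ℝ) := by simp
  set N : ℝ := (k.1.natAbs : ℝ)
  have e : om k = ((1 + N) ^ 2)⁻¹ := by
    unfold om; rw [habs, h2]; simp
  rw [e, ← div_eq_mul_inv, le_div_iff₀ (by positivity), ← sq_abs (pp a k)]
  have : N * |pp a k| ≤ C := le_trans (by gcongr) hb
  calc |pp a k| ^ 2 * (1 + N) ^ 2 ≤ |pp a k| ^ 2 * (2 * N) ^ 2 := by gcongr; linarith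
    _ = 4 * (N * |pp a k|) ^ 2 := by ring
    _ ≤ _ := by gcongr
end


open scoped BigOperators
open MeasureTheory
noncomputable section

lemma pb_one_add (n : ℕ) : PB fun k => (1 + znorm k ^ 2) ^ n :=
  ((PB.const 1).add (PB.znorm.pow 2)).pow n

lemma snapshot (Θ : SQGSol) (hev : Θ.IsEven)
    (hodd : ∀ t : ℝ, 0 ≤ t → ∀ k : ℤ × ℤ, Odd k.2 → Θ.θ t k = 0)
    {σ B : ℝ} (hB : 0 < B) (h0 : ∀ k, Θ.θ 0 k = pdat (σ ^ 11) k) (hσ0 : 0 < σ) (hσ1 : σ ≤ 1 / 2)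
    (hK1 : σ * (4 * (6 + B) ^ 2 * omS) ≤ 1)
    (hK2 : σ * (1024 * (1 + 2 * B) ^ 4 * ((6 + B ^ 2) * (8 * omS + (6 + B ^ 2) / 2))) ≤ 1)
    {t : ℝ} (ht : 0 ≤ t)
    (hbd : ∑' k, (1 + znorm k ^ 2) ^ 11 * Θ.θ t k ^ 2 ≤ B ^ 2) :
    σ ^ 26 / (256 * (1 + 2 * B) ^ 4) ≤ ∑' k, Phi k * (Dn (Θ.θ t) k * Θ.θ t (k + (1, 0))
      + Θ.θ t k * Dn (Θ.θ t) (k + (1, 0))) := by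
  have ha := Θ.RD ht
  have hae := hev t ht
  have hao := hodd t ht
  have ha0 := Θ.zero_mode t ht
  have hτ : (σ ^ 11) ^ 2 ≤ 1 / 4 := by
    calc (σ ^ 11) ^ 2 = σ ^ 22 := by ring
      _ ≤ (1 / 2) ^ 22 := by gcongr
      _ ≤ _ := by norm_num
  have hsq : (σ ^ 11) ^ 2 = σ ^ 22 := by ring
  have hpb := pert_bounds Θ hev hodd h0 ht
  have hhb := h_bounds Θ hev hodd h0 hτ ht
  have hsh : ∀ n : ℕ, 2 ≤ n → |Θ.θ t (n, 0)| ≤ 6 * n ^ 2 * σ ^ 22 := fun n hn => by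
    have := shear_le Θ hev hodd h0 hτ ht hn
    rwa [hsq] at this
  rw [hsq] at hpb
  set a := Θ.θ t with hadef
  have hσ1' : σ ≤ 1 := by linarith
  have s11 : Summable fun k => (1 + znorm k ^ 2) ^ 11 * a k ^ 2 :=
    (ha.sq.weight (pb_one_add 11)).summable
  have w22 : ∀ k, znorm k ^ 22 ≤ (1 + znorm k ^ 2) ^ 11 := fun k => by
    calc znorm k ^ 22 = (znorm k ^ 2) ^ 11 := by ring
      _ ≤ _ := by gcongr; linarith
  have H22 : ∑' k, znorm k ^ 22 * a k ^ 2 ≤ B ^ 2 := by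
    refine le_trans ((ha.znsq 22).tsum_le_tsum (fun k => ?_) s11) hbd
    gcongr
    exact w22 k
  have H22p : ∑' k, znorm k ^ 22 * pp a k ^ 2 ≤ B ^ 2 := by
    refine le_trans ((ha.pp.znsq 22).tsum_le_tsum (fun k => ?_) (ha.znsq 22)) H22
    have := znorm_nonneg k
    refine mul_le_mul_of_nonneg_left ?_ (by positivity)
    unfold pp; split_ifs
    · simpa using sq_nonneg (a k)
    · exact le_rfl
  have hpt : ∀ k, znorm k ^ 11 * |a k| ≤ B := fun k => by
    have := (ha.znsq 22).le_tsum k (fun j _ => by have := znorm_nonneg j; positivity)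
    have h2 : (znorm k ^ 11 * |a k|) ^ 2 ≤ B ^ 2 := by
      rw [mul_pow, sq_abs]
      calc _ = znorm k ^ 22 * a k ^ 2 := by ring
        _ ≤ _ := this.trans H22
    exact (abs_le_of_sq_le_sq' h2 hB.le).2
  -- shear
  have hsh2 : ∀ n : ℕ, 2 ≤ n → n * |a (n, 0)| ≤ (6 + B) * σ ^ 16 := fun n hn => by
    have hn0 : (0:ℝ) ≤ n := by positivity
    rcases le_total ((n:ℝ) * σ ^ 2) 1 with h | h
    · have h3 : ((n:ℝ) * σ ^ 2) ^ 3 ≤ 1 := pow_le_one₀ (by positivity) h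
      calc n * |a (n, 0)| ≤ n * (6 * n ^ 2 * σ ^ 22) := by gcongr; exact hsh n hn
        _ = 6 * σ ^ 16 * ((n:ℝ) * σ ^ 2) ^ 3 := by ring
        _ ≤ 6 * σ ^ 16 * 1 := by gcongr
        _ ≤ _ := by nlinarith [pow_pos hσ0 16]
    · have h3 : 1 ≤ ((n:ℝ) * σ ^ 2) ^ 10 := one_le_pow₀ h
      have hz : znorm ((n:ℤ), 0) = n := by
        unfold znorm; simp
      have := hpt (n, 0)
      rw [hz] at this
      calc n * |a (n, 0)| ≤ n * |a (n, 0)| * ((n:ℝ) * σ ^ 2) ^ 10 :=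
            le_mul_of_one_le_right (by positivity) h3
        _ = ((n:ℝ) ^ 11 * |a (n, 0)|) * σ ^ 20 := by ring
        _ ≤ B * σ ^ 20 := by gcongr
        _ ≤ B * σ ^ 16 := by
            refine mul_le_mul_of_nonneg_left ?_ hB.le
            exact pow_le_pow_of_le_one hσ0.le hσ1' (by norm_num)
        _ ≤ _ := by nlinarith [pow_pos hσ0 16]
  have hss := shear_sum ha hae ha0 hsh2
  have hss2 : 4 * ((6 + B) * σ ^ 16) ^ 2 * omS ≤ σ ^ 22 := by
    have h10 : σ ^ 10 ≤ σ := by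
      calc σ ^ 10 ≤ σ ^ 1 := pow_le_pow_of_le_one hσ0.le hσ1' (by norm_num)
        _ = σ := pow_one σ
    have homS := omS_pos
    calc 4 * ((6 + B) * σ ^ 16) ^ 2 * omS = σ ^ 22 * (σ ^ 10 * (4 * (6 + B) ^ 2 * omS)) := by ring
      _ ≤ σ ^ 22 * (σ * (4 * (6 + B) ^ 2 * omS)) := by gcongr
      _ ≤ σ ^ 22 * 1 := by gcongr
      _ = _ := mul_one _
  have huh := upper_half ha hae hao
  have hG : σ ^ 22 / 2 ≤ ∑' k : ℤ × ℤ, (if 2 ≤ k.2 then a k ^ 2 else 0) := by linarith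
  -- linear lower bound
  set M := 1 + 2 * B with hM
  have hM1 : 1 ≤ M := by linarith
  have hR : 1 ≤ M / σ := by rw [one_le_div hσ0]; linarith
  have hcc := cc_sum_lower ha hR hG H22
  have hlow : σ ^ 26 / (64 * M ^ 4) ≤ (16 * (M / σ) ^ 4)⁻¹ * (σ ^ 22 / 2 - ((M / σ) ^ 22)⁻¹ * B ^ 2) := by
    have hM22 : 4 * B ^ 2 ≤ M ^ 22 := by
      calc 4 * B ^ 2 ≤ M ^ 2 := by rw [hM]; nlinarith
        _ ≤ M ^ 22 := pow_le_pow_right₀ hM1 (by norm_num)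
    have h1 : ((M / σ) ^ 22)⁻¹ * B ^ 2 ≤ σ ^ 22 / 4 := by
      rw [div_pow, inv_div, div_mul_eq_mul_div, div_le_div_iff₀ (by positivity) (by norm_num)]
      nlinarith [pow_pos hσ0 22]
    calc σ ^ 26 / (64 * M ^ 4) = (16 * (M / σ) ^ 4)⁻¹ * (σ ^ 22 / 4) := by field_simp; norm_num
      _ ≤ _ := by gcongr; linarith
  -- error
  set D := 6 + B ^ 2 with hD
  have hDpos : 0 < D := by positivity
  have hmom : ∀ j ≤ 22, σ ^ j * ∑' k, znorm k ^ j * pp a k ^ 2 ≤ D * σ ^ 22 := fun j hj =>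
    mom_le ha.pp hσ0.le hpb.2 H22p hj
  have hN := Dn_le ha.pp (D := D) hσ0 (by simpa using hmom 0 (by norm_num)) (hmom 2 (by norm_num))
  have hS := sum_abs_le ha.pp hσ0 (hmom 6 (by norm_num))
  have hE := Err_le ha (by positivity) hN hS
  have hEs : 4 * (D * σ ^ 21) * (σ ^ 8 * (8 * omS + D / 2)) ≤ σ ^ 26 / (256 * M ^ 4) := by
    rw [le_div_iff₀ (by positivity)]
    have h3 : σ ^ 3 ≤ σ := by
      calc σ ^ 3 ≤ σ ^ 1 := pow_le_pow_of_le_one hσ0.le hσ1' (by norm_num)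
        _ = σ := pow_one σ
    have homS := omS_pos
    calc 4 * (D * σ ^ 21) * (σ ^ 8 * (8 * omS + D / 2)) * (256 * M ^ 4)
        = σ ^ 26 * (σ ^ 3 * (1024 * M ^ 4 * (D * (8 * omS + D / 2)))) := by ring
      _ ≤ σ ^ 26 * (σ * (1024 * M ^ 4 * (D * (8 * omS + D / 2)))) := by gcongr
      _ ≤ σ ^ 26 * 1 := by gcongr
      _ = _ := mul_one _
  have hJ := J_lower ha hae (by linarith [hhb.1])
  refine le_trans ?_ hJ
  have hprod : 1 / 2 * (σ ^ 26 / (64 * M ^ 4)) ≤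
      a (1, 0) * ∑' k : ℤ × ℤ, (if 2 ≤ k.2 then cc k * (phi k * a k) ^ 2 else 0) :=
    mul_le_mul hhb.1 (hlow.trans hcc) (by positivity) (by linarith [hhb.1])
  have hEa := (abs_le.mp hE).1
  have e : 1 / 2 * (σ ^ 26 / (64 * M ^ 4)) = 2 * (σ ^ 26 / (256 * M ^ 4)) := by field_simp; norm_num
  linarith

lemma J_bdd {a : ℤ × ℤ → ℝ} (ha : RD a) {B : ℝ}
    (hbd : ∑' k, (1 + znorm k ^ 2) ^ 11 * a k ^ 2 ≤ B ^ 2) :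
    |∑' k, Phi k * (a k * a (k + (1, 0)))| ≤ 3 * B ^ 2 := by
  have s11 : Summable fun k => (1 + znorm k ^ 2) ^ 11 * a k ^ 2 :=
    (ha.sq.weight (pb_one_add 11)).summable
  have hs : Summable fun k => Phi k * (a k * a (k + (1, 0))) :=
    ((ha.mul (ha.shift (1, 0))).weight pb_Phi).summable
  set F := fun k => (1 + znorm k ^ 2) ^ 11 * a k ^ 2 with hF
  have s11' : Summable fun k : ℤ × ℤ => F (k + (1, 0)) :=
    (Equiv.addRight ((1, 0) : ℤ × ℤ)).summable_iff (f := F) |>.mpr s11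
  have e11' : ∑' k : ℤ × ℤ, F (k + (1, 0)) = ∑' k, F k :=
    (Equiv.addRight ((1, 0) : ℤ × ℤ)).tsum_eq F
  calc _ ≤ ∑' k, |Phi k * (a k * a (k + (1, 0)))| := by
        simpa using norm_tsum_le_tsum_norm hs.norm
    _ ≤ ∑' k, (2 * F k + F (k + (1, 0))) := by
        refine hs.abs.tsum_le_tsum (fun k => ?_) ((s11.mul_left 2).add s11')
        have w : ∀ k, 1 + znorm k ^ 2 ≤ (1 + znorm k ^ 2) ^ 11 := fun k =>
          le_self_pow₀ (by nlinarith [sq_nonneg (znorm k)]) (by norm_num)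
        have f1 : znorm k ^ 2 * a k ^ 2 ≤ F k := by
          simp only [hF]; gcongr; linarith [w k]
        have f2 : a (k + (1, 0)) ^ 2 ≤ F (k + (1, 0)) := by
          simp only [hF]
          exact le_mul_of_one_le_left (sq_nonneg _)
            (by nlinarith [w (k + (1, 0)), sq_nonneg (znorm (k + (1, 0)))])
        have hP := (abs_Phi_le k).1
        rw [abs_mul, abs_mul]
        have h1 : |Phi k| * (|a k| * |a (k + (1, 0))|) ≤
            2 * znorm k * (|a k| * |a (k + (1, 0))|) := by gcongr
        rw [← sq_abs (a k)] at f1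
        rw [← sq_abs (a (k + (1, 0)))] at f2
        nlinarith [sq_nonneg (znorm k * |a k| - |a (k + (1, 0))|)]
    _ = 3 * ∑' k, F k := by
        rw [(s11.mul_left 2).tsum_add s11', tsum_mul_left, e11']; ring
    _ ≤ _ := by gcongr

lemma growth {B : ℝ} (hB : 0 < B) : ∃ τ : ℝ, 0 < τ ∧ τ < 1 ∧ ∀ Θ : SQGSol, Θ.IsEven →
    (∀ k, Θ.θ 0 k = pdat τ k) →
    (∀ t : ℝ, 0 ≤ t → ∀ k : ℤ × ℤ, Odd k.2 → Θ.θ t k = 0) →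
    ∀ T : ℝ, ∃ t, T ≤ t ∧ 0 ≤ t ∧ B ^ 2 ≤ ∑' k, (1 + znorm k ^ 2) ^ 11 * Θ.θ t k ^ 2 := by
  set K1 := 4 * (6 + B) ^ 2 * omS with hK1
  set K2 := 1024 * (1 + 2 * B) ^ 4 * ((6 + B ^ 2) * (8 * omS + (6 + B ^ 2) / 2)) with hK2
  have homS := omS_pos
  have p1 : 0 < K1 := by positivity
  have p2 : 0 < K2 := by positivity
  set σ := 1 / (2 + K1 + K2) with hσ
  have hσ0 : 0 < σ := by positivity
  have hσ1 : σ ≤ 1 / 2 := by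
    rw [hσ]; exact one_div_le_one_div_of_le (by norm_num) (by linarith)
  have b1 : σ * K1 ≤ 1 := by
    rw [hσ, one_div_mul_eq_div, div_le_one (by positivity)]; linarith
  have b2 : σ * K2 ≤ 1 := by
    rw [hσ, one_div_mul_eq_div, div_le_one (by positivity)]; linarith
  refine ⟨σ ^ 11, by positivity, pow_lt_one₀ hσ0.le (by linarith) (by norm_num), ?_⟩
  intro Θ hev h0 hodd T
  by_contra hcon
  push Not at hcon
  set c := σ ^ 26 / (256 * (1 + 2 * B) ^ 4) with hc
  have hcpos : 0 < c := by positivity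
  set t1 := max T 0 + 1 with ht1
  have hT1 : T ≤ t1 := by have := le_max_left T 0; linarith
  have h01 : 0 < t1 := by have := le_max_right T 0; linarith
  have hbd : ∀ t, t1 ≤ t → ∑' k, (1 + znorm k ^ 2) ^ 11 * Θ.θ t k ^ 2 ≤ B ^ 2 := fun t ht =>
    (hcon t (by linarith) (by linarith)).le
  set J : ℝ → ℝ := fun s => ∑' k, Phi k * (Θ.θ s k * Θ.θ s (k + (1, 0))) with hJ
  have hd : ∀ t, t1 ≤ t → HasDerivAt J (∑' k, Phi k * (Dn (Θ.θ t) k * Θ.θ t (k + (1, 0))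
      + Θ.θ t k * Dn (Θ.θ t) (k + (1, 0)))) t := fun t ht =>
    Θ.quad_deriv pb_Phi (1, 0) (by linarith)
  set L := (7 * B ^ 2) / c with hL
  have hL0 : 0 < L := by positivity
  have hmv := Convex.mul_sub_le_image_sub_of_le_deriv (convex_Icc t1 (t1 + L)) (f := J)
    (fun t ht => (hd t ht.1).continuousAt.continuousWithinAt)
    (fun t ht => (hd t (interior_subset ht).1).differentiableAt.differentiableWithinAt)
    (C := c) (fun t ht => by
      have ht' := (interior_subset ht).1
      rw [(hd t ht').deriv]
      exact snapshot Θ hev hodd hB h0 hσ0 hσ1 b1 b2 (by linarith) (hbd t ht'))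
    t1 ⟨le_rfl, by linarith⟩ (t1 + L) ⟨by linarith, le_rfl⟩ (by linarith)
  have e : c * (t1 + L - t1) = 7 * B ^ 2 := by
    rw [add_sub_cancel_left, hL]; field_simp
  rw [e] at hmv
  have j1 := J_bdd (Θ.RD h01.le) (hbd t1 le_rfl)
  have j2 := J_bdd (Θ.RD (t := t1 + L) (by linarith)) (hbd (t1 + L) (by linarith))
  have j1' := (abs_le.mp j1).1
  have j2' := (abs_le.mp j2).2
  have : 0 < B ^ 2 := by positivity
  simp only [hJ] at hmv
  linarith
end


open scoped BigOperators
open MeasureTheory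
noncomputable section

lemma sqgSummand_smul (c : ℝ) (a : ℤ × ℤ → ℝ) (k l : ℤ × ℤ) :
    sqgSummand (fun j => c * a j) k l = c ^ 2 * sqgSummand a k l := by
  unfold sqgSummand
  split_ifs
  · ring
  · simp

/-- The scaling symmetry of the equation. -/
def SQGSol.rescale (Θ : SQGSol) (c : ℝ) (hc : 0 < c) : SQGSol where
  θ := fun t k => c * Θ.θ (c * t) k
  zero_mode := fun t ht => by
    rw [Θ.zero_mode _ (by positivity), mul_zero]
  rhs_summable := fun t ht k => by
    simp only [sqgSummand_smul, abs_mul]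
    exact (Θ.rhs_summable _ (by positivity) k).mul_left _
  ode := fun k t ht => by
    have h1 := Θ.ode k (c * t) (by positivity)
    have h2 : HasDerivWithinAt (fun s : ℝ => c * s) c (Set.Ici 0) t := by
      simpa using ((hasDerivAt_id t).const_mul c).hasDerivWithinAt (s := Set.Ici 0)
    have hm : Set.MapsTo (fun s : ℝ => c * s) (Set.Ici 0) (Set.Ici 0) := fun s hs => by
      have : (0 : ℝ) ≤ s := hs
      show (0 : ℝ) ≤ c * s
      positivity
    have h3 := (HasDerivWithinAt.scomp (h := fun s : ℝ => c * s) t h1 h2 hm).const_mul c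
    refine h3.congr_deriv ?_
    simp only [sqgSummand_smul, tsum_mul_left, smul_eq_mul]
    ring
  decay := fun T hT N => by
    obtain ⟨M, hM⟩ := Θ.decay (c * T) (by positivity) N
    refine ⟨c * M, fun t ht k => ?_⟩
    have := hM (c * t) ⟨by have := ht.1; positivity, by have := ht.2; gcongr⟩ k
    rw [abs_mul, abs_of_pos hc]
    calc _ = c * ((1 + znorm k) ^ N * |Θ.θ (c * t) k|) := by ring
      _ ≤ _ := by gcongr

lemma main_aux (s : ℝ) (hs : 11 ≤ s) (A : ℝ) (hA : 0 < A) :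
    ∃ (τ lam : ℝ) (a : ℤ × ℤ → ℝ),
      0 < τ ∧ τ < 1 ∧ 0 < lam ∧
      a = (fun k => lam * pdat τ k) ∧
      (Function.support a).Finite ∧
      (∀ k : ℤ × ℤ, a (-k) = a k) ∧
      a 0 = 0 ∧
      (∀ k : ℤ × ℤ, Odd k.2 → a k = 0) ∧
      (∑' k : ℤ × ℤ, (1 + znorm k ^ 2) ^ s * a k ^ 2) ≤ 1 ∧
      ∀ Θ : SQGSol, Θ.IsEven →
        (∀ k : ℤ × ℤ, Θ.θ 0 k = a k) →
        (∀ t : ℝ, 0 ≤ t → ∀ k : ℤ × ℤ, Odd k.2 → Θ.θ t k = 0) →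
        ((A ^ 2 : ℝ) : EReal) ≤
          Filter.limsup
            (fun t : ℝ =>
              ((∑' k : ℤ × ℤ, (1 + znorm k ^ 2) ^ s * Θ.θ t k ^ 2 : ℝ) : EReal))
            Filter.atTop := by
  have h6 : (1 : ℝ) ≤ 6 ^ s := Real.one_le_rpow (by norm_num) (by linarith)
  set lam : ℝ := (6 * 6 ^ s)⁻¹ with hlam
  have hl0 : 0 < lam := by positivity
  have hl1 : lam ≤ 1 := inv_le_one_of_one_le₀ (by linarith)
  have hl6 : lam * (6 * 6 ^ s) = 1 := inv_mul_cancel₀ (by positivity)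
  obtain ⟨τ, hτ0, hτ1, hg⟩ := growth (B := A / lam) (by positivity)
  refine ⟨τ, lam, _, hτ0, hτ1, hl0, rfl, ?_, ?_, ?_, ?_, ?_, ?_⟩
  · refine (pdat_finite τ).subset fun k hk => ?_
    simp only [Function.mem_support] at hk ⊢
    exact right_ne_zero_of_mul hk
  · intro k; simp only [pdat_even]
  · simp [pdat, Prod.ext_iff]
  · intro k hk
    have : pdat τ k = 0 := by
      by_contra h
      have := pdat_support τ h
      simp at this
      rcases this with h | h | h | h | h | h <;> · subst h; revert hk; decide
    simp [this]
  · have := tsum_pdat τ (fun k x => (1 + znorm k ^ 2) ^ s * (lam * x) ^ 2) (by simp)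
    rw [this]
    have e : ∀ x : ℝ, 0 ≤ x → x ≤ 6 → ∀ y : ℝ, 0 ≤ y → y ≤ 1 →
        x ^ s * (lam * y) ^ 2 ≤ 6 ^ s * lam := fun x hx hx6 y hy hy1 => by
      have h1 : x ^ s ≤ 6 ^ s := Real.rpow_le_rpow hx hx6 (by linarith)
      have h0 : 0 ≤ lam * y := by positivity
      have h3 : lam * y ≤ lam := by nlinarith
      have h2 : (lam * y) ^ 2 ≤ lam := by nlinarith
      have := Real.rpow_nonneg hx s
      gcongr
    have e1 := e (1 + znorm (1, 0) ^ 2) (by positivity) (by rw [znorm_sq]; norm_num) 1 (by norm_num) le_rfl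
    have e2 := e (1 + znorm (-1, 0) ^ 2) (by positivity) (by rw [znorm_sq]; norm_num) 1 (by norm_num) le_rfl
    have e3 := e (1 + znorm (0, 2) ^ 2) (by positivity) (by rw [znorm_sq]; norm_num) τ hτ0.le hτ1.le
    have e4 := e (1 + znorm (0, -2) ^ 2) (by positivity) (by rw [znorm_sq]; norm_num) τ hτ0.le hτ1.le
    have e5 := e (1 + znorm (1, 2) ^ 2) (by positivity) (by rw [znorm_sq]; norm_num) τ hτ0.le hτ1.le
    have e6 := e (1 + znorm (-1, -2) ^ 2) (by positivity) (by rw [znorm_sq]; norm_num) τ hτ0.le hτ1.le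
    linarith
  · intro Θ hev h0 hodd
    have hi : 0 < lam⁻¹ := by positivity
    have key := hg (Θ.rescale lam⁻¹ hi)
      (fun t ht k => by
        show lam⁻¹ * _ = lam⁻¹ * _
        rw [hev _ (by positivity)])
      (fun k => by
        show lam⁻¹ * Θ.θ (lam⁻¹ * 0) k = _
        rw [mul_zero, h0, inv_mul_cancel_left₀ hl0.ne'])
      (fun t ht k hk => by
        show lam⁻¹ * Θ.θ (lam⁻¹ * t) k = _
        rw [hodd _ (by positivity) k hk, mul_zero])
    refine Filter.le_limsup_of_frequently_le ?_
    rw [Filter.frequently_atTop]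
    intro T
    obtain ⟨t, hTt, ht0, ht⟩ := key (lam * T)
    refine ⟨lam⁻¹ * t, ?_, ?_⟩
    · rw [inv_mul_eq_div, le_div_iff₀ hl0]; linarith
    rw [EReal.coe_le_coe_iff]
    have hpos : 0 ≤ lam⁻¹ * t := by positivity
    have hRD := Θ.RD hpos
    set b := Θ.θ (lam⁻¹ * t) with hb
    have ht' : (A / lam) ^ 2 ≤ ∑' k, (lam⁻¹) ^ 2 * ((1 + znorm k ^ 2) ^ 11 * b k ^ 2) := by
      refine ht.trans_eq (tsum_congr fun k => ?_)
      show _ * (lam⁻¹ * Θ.θ (lam⁻¹ * t) k) ^ 2 = _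
      rw [hb]; ring
    rw [tsum_mul_left] at ht'
    have h11 : A ^ 2 ≤ ∑' k, (1 + znorm k ^ 2) ^ 11 * b k ^ 2 := by
      have := mul_le_mul_of_nonneg_left ht' (sq_nonneg lam)
      rw [← mul_assoc, ← mul_pow, ← mul_pow, mul_div_cancel₀ _ hl0.ne', mul_inv_cancel₀ hl0.ne',
        one_pow, one_mul] at this
      exact this
    have hw1 : ∀ k, 1 ≤ 1 + znorm k ^ 2 := fun k => by nlinarith [sq_nonneg (znorm k)]
    refine h11.trans (Summable.tsum_le_tsum (fun k => ?_)
      (hRD.sq.weight (pb_one_add 11)).summable ?_)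
    · refine mul_le_mul_of_nonneg_right ?_ (sq_nonneg _)
      rw [← Real.rpow_natCast]
      exact Real.rpow_le_rpow_of_exponent_le (hw1 k) (by exact_mod_cast hs)
    · refine Summable.of_nonneg_of_le (fun k => ?_) (fun k => ?_)
        (hRD.sq.weight (pb_one_add ⌈s⌉₊)).summable
      · have := hw1 k; positivity
      · refine mul_le_mul_of_nonneg_right ?_ (sq_nonneg _)
        rw [← Real.rpow_natCast (1 + znorm k ^ 2)]
        exact Real.rpow_le_rpow_of_exponent_le (hw1 k) (Nat.le_ceil s)

end

/-- **Theorem 1.** For every `s ≥ 11` and `A > 0` there are `τ ∈ (0,1)`, `λ > 0` and a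
finitely supported even initial datum `a = λ • p_τ` with `a₀ = 0`, vanishing on odd `k₂`,
of `H^s` norm at most `1`, such that every even rapidly decaying Fourier-side SQG solution
starting from `a` (and vanishing on odd `k₂` for all times) satisfies
`limsup_{t→∞} ‖θ(t)‖_{H^s}² ≥ A²`. -/
theorem sqg_norm_growth (s : ℝ) (hs : 11 ≤ s) (A : ℝ) (hA : 0 < A) :
    ∃ (τ lam : ℝ) (a : ℤ × ℤ → ℝ),
      0 < τ ∧ τ < 1 ∧ 0 < lam ∧
      a = (fun k => lam * pdat τ k) ∧
      (Function.support a).Finite ∧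
      (∀ k : ℤ × ℤ, a (-k) = a k) ∧
      a 0 = 0 ∧
      (∀ k : ℤ × ℤ, Odd k.2 → a k = 0) ∧
      (∑' k : ℤ × ℤ, (1 + znorm k ^ 2) ^ s * a k ^ 2) ≤ 1 ∧
      ∀ Θ : SQGSol, Θ.IsEven →
        (∀ k : ℤ × ℤ, Θ.θ 0 k = a k) →
        (∀ t : ℝ, 0 ≤ t → ∀ k : ℤ × ℤ, Odd k.2 → Θ.θ t k = 0) →
        ((A ^ 2 : ℝ) : EReal) ≤
          Filter.limsup
            (fun t : ℝ =>
              ((∑' k : ℤ × ℤ, (1 + znorm k ^ 2) ^ s * Θ.θ t k ^ 2 : ℝ) : EReal))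
            Filter.atTop := by
  exact main_aux s hs A hA
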